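/- arXiv:2603.10589 — 6 statements merged into one kernel-verified Lean document; each statement's English description precedes it below -/
import Mathlib

section
/- Let c : ℕ ≃ ℕ be a bijection such that the conjugated successor c ∘ S ∘ c⁻¹ (where S x = x + 1) is primitive recursive. Then the following are equivalent: (1) both c and c⁻¹ are primitive recursive; (2) for every function f : ℕ → ℕ, f is primitive recursive if and only if c ∘ f ∘ c⁻¹ is primitive recursive. -/
/-- If `g` is primitive recursive and `e` intertwines the successor with `g`, then `e` is primitive
recursive. -/
theorem Primrec.of_succ_eq {e g : ℕ → ℕ} (hg : Primrec g) (he : ∀ n, e (n + 1) = g (e n)) :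
    Primrec e :=
  (Primrec.nat_iterate .id (.const (e 0)) (hg.comp₂ Primrec₂.right)).of_eq fun n => by
    induction n with
    | zero => rfl
    | succ n ih => rw [he, ← ih]; exact Function.iterate_succ_apply' _ _ _

theorem stmt_0 (c : ℕ ≃ ℕ) (h : Primrec fun x => c (c.symm x + 1)) :
    (Primrec (c : ℕ → ℕ) ∧ Primrec (c.symm : ℕ → ℕ)) ↔
      (∀ f : ℕ → ℕ, Primrec f ↔ Primrec fun x => c (f (c.symm x))) := by
  constructor
  · rintro ⟨hc, hd⟩ f
    refine ⟨fun hf => hc.comp (hf.comp hd), fun hf => ?_⟩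
    exact (hd.comp (hf.comp hc)).of_eq fun n => by simp
  · intro H
    refine ⟨h.of_succ_eq fun n => by simp, ?_⟩
    have hs : Primrec fun n => c.symm (c n + 1) :=
      (H _).2 (Primrec.succ.of_eq fun n => by simp)
    exact hs.of_succ_eq fun n => by simp
end

section
/- There exists a bijection c : ℕ ≃ ℕ such that: (1) c ∘ S ∘ c⁻¹ is primitive recursive (where S x = x + 1); (2) the binary relation (x, y) ↦ (c⁻¹ x ≤ c⁻¹ y) is primitive recursive; and (3) for every primitive recursive function f : ℕ → ℕ satisfying 2·x ≤ f x for all sufficiently large x, the conjugate c ∘ f ∘ c⁻¹ is not primitive recursive. -/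
open Filter

/-- The largest boundary `≤ x`, where `0` is a boundary and the boundary following `a` is the least
even number `k > a` with `R a k`. -/
def blockStart (R : ℕ → ℕ → Prop) [DecidableRel R] (x : ℕ) : ℕ :=
  Nat.rec 0 (fun n a => if (n + 1) % 2 = 0 ∧ R a (n + 1) then n + 1 else a) x

/-- The successor of the ordering of `ℕ` in which the blocks between consecutive boundaries follow
each other, and each block lists first its even and then its odd elements. -/
def blockSucc (R : ℕ → ℕ → Prop) [DecidableRel R] (x : ℕ) : ℕ :=
  if x % 2 = 0 then if blockStart R (x + 2) = x + 2 then blockStart R x + 1 else x + 2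
  else if blockStart R (x + 1) = x + 1 then x + 1 else x + 2

/-- The ordering of `ℕ` block by block, even elements of each block before the odd ones. -/
def BlockLE (R : ℕ → ℕ → Prop) [DecidableRel R] (x y : ℕ) : Prop :=
  blockStart R x < blockStart R y ∨ blockStart R x = blockStart R y ∧
    (x % 2 < y % 2 ∨ x % 2 = y % 2 ∧ x ≤ y)

section Blocks

variable {R : ℕ → ℕ → Prop} [DecidableRel R]

theorem blockStart_zero : blockStart R 0 = 0 := rfl

theorem blockStart_succ (x : ℕ) : blockStart R (x + 1) =
    if (x + 1) % 2 = 0 ∧ R (blockStart R x) (x + 1) then x + 1 else blockStart R x := rfl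

theorem blockStart_le (x : ℕ) : blockStart R x ≤ x := by
  induction x with
  | zero => rfl
  | succ x ih => rw [blockStart_succ]; split_ifs <;> omega

theorem blockStart_mod_two (x : ℕ) : blockStart R x % 2 = 0 := by
  induction x with
  | zero => rfl
  | succ x ih => rw [blockStart_succ]; split_ifs with h <;> omega

theorem blockStart_mono : Monotone (blockStart R) := by
  refine monotone_nat_of_le_succ fun x => ?_
  have := blockStart_le (R := R) x
  rw [blockStart_succ]; split_ifs <;> omega

theorem blockStart_blockStart (x : ℕ) : blockStart R (blockStart R x) = blockStart R x := by
  induction x with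
  | zero => rfl
  | succ x ih =>
    by_cases h : (x + 1) % 2 = 0 ∧ R (blockStart R x) (x + 1)
    · have : blockStart R (x + 1) = x + 1 := by rw [blockStart_succ, if_pos h]
      rw [this, this]
    · rw [blockStart_succ, if_neg h, ih]

theorem blockStart_eq_of_no_boundary {x : ℕ} (k : ℕ)
    (h : ∀ b, x < b → b ≤ x + k → blockStart R b ≠ b) : blockStart R (x + k) = blockStart R x := by
  induction k with
  | zero => rfl
  | succ k ih =>
    have hb := h (x + k + 1) (by omega) (by omega)
    rw [blockStart_succ] at hb
    rw [← add_assoc, blockStart_succ, ← ih fun b h₁ h₂ => h b h₁ (by omega)]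
    split_ifs at hb ⊢ with h'
    · exact absurd rfl hb
    · rfl

theorem exists_boundary_gt (hR : ∀ a, ∀ᶠ k in atTop, R a k) (x : ℕ) :
    ∃ b, x < b ∧ blockStart R b = b := by
  by_contra! h
  obtain ⟨k, hk⟩ := eventually_atTop.1 (hR (blockStart R x))
  refine h (2 * (x + k) + 2) (by omega) ?_
  have h₁ := blockStart_eq_of_no_boundary (R := R) (x := x) (x + 2 * k + 1) fun b hb _ => h b hb
  rw [show x + (x + 2 * k + 1) = 2 * (x + k) + 1 by omega] at h₁
  rw [show 2 * (x + k) + 2 = 2 * (x + k) + 1 + 1 by omega, blockStart_succ, h₁,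
    if_pos ⟨by omega, hk _ (by omega)⟩]

/-- The least boundary `> x`. -/
def blockEnd (hR : ∀ a, ∀ᶠ k in atTop, R a k) (x : ℕ) : ℕ := Nat.find (exists_boundary_gt hR x)

variable (hR : ∀ a, ∀ᶠ k in atTop, R a k)

theorem lt_blockEnd (x : ℕ) : x < blockEnd hR x := (Nat.find_spec (exists_boundary_gt hR x)).1

theorem blockStart_blockEnd (x : ℕ) : blockStart R (blockEnd hR x) = blockEnd hR x :=
  (Nat.find_spec (exists_boundary_gt hR x)).2

theorem blockEnd_le {x b : ℕ} (hx : x < b) (hb : blockStart R b = b) : blockEnd hR x ≤ b :=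
  Nat.find_min' _ ⟨hx, hb⟩

theorem blockEnd_mod_two (x : ℕ) : blockEnd hR x % 2 = 0 := by
  rw [← blockStart_blockEnd hR x]; exact blockStart_mod_two _

theorem blockStart_eq_of_lt_blockEnd {x y : ℕ} (h : x ≤ y) (hy : y < blockEnd hR x) :
    blockStart R y = blockStart R x := by
  obtain ⟨k, rfl⟩ := Nat.exists_eq_add_of_le h
  refine blockStart_eq_of_no_boundary k fun b h₁ h₂ hb => ?_
  have := blockEnd_le hR h₁ hb
  omega

theorem blockEnd_eq_of_lt_blockEnd {x y : ℕ} (h : x ≤ y) (hy : y < blockEnd hR x) :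
    blockEnd hR y = blockEnd hR x :=
  le_antisymm (blockEnd_le hR hy (blockStart_blockEnd hR x))
    (blockEnd_le hR (h.trans_lt (lt_blockEnd hR y)) (blockStart_blockEnd hR y))

theorem blockEnd_le_blockStart {x y : ℕ} (h : blockStart R x < blockStart R y) :
    blockEnd hR x ≤ blockStart R y := by
  refine blockEnd_le hR ?_ (blockStart_blockStart y)
  by_contra! h'
  have := blockStart_mono (R := R) h'
  rw [blockStart_blockStart] at this
  omega

theorem blockEnd_eq_of_blockStart_eq {x y : ℕ} (h : blockStart R x = blockStart R y) :
    blockEnd hR x = blockEnd hR y := by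
  wlog hxy : x ≤ y generalizing x y
  · exact (this h.symm (by omega)).symm
  refine (blockEnd_eq_of_lt_blockEnd hR hxy ?_).symm
  by_contra! h'
  have h₁ := blockStart_mono (R := R) h'
  rw [blockStart_blockEnd] at h₁
  have h₂ := lt_blockEnd hR x
  have h₃ := blockStart_le (R := R) x
  omega

theorem rel_blockStart_blockEnd (x : ℕ) : R (blockStart R x) (blockEnd hR x) := by
  have hx := lt_blockEnd hR x
  obtain ⟨b, hb⟩ : ∃ b, blockEnd hR x = b + 1 := ⟨blockEnd hR x - 1, by omega⟩
  have h := blockStart_blockEnd hR x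
  have h' := blockStart_eq_of_lt_blockEnd hR (x := x) (y := b) (by omega) (by omega)
  rw [hb, blockStart_succ, h'] at h
  rw [hb]
  split_ifs at h with hc
  · exact hc.2
  · have := blockStart_le (R := R) x
    omega

/-- The position of `x` in the ordering `BlockLE R`. -/
def blockPos (x : ℕ) : ℕ :=
  if x % 2 = 0 then (blockStart R x + x) / 2 else (blockEnd hR x + x) / 2

theorem blockStart_le_blockPos (x : ℕ) : blockStart R x ≤ blockPos hR x := by
  have := blockStart_le (R := R) x
  have := lt_blockEnd hR x
  unfold blockPos; split_ifs <;> omega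

theorem blockPos_lt_blockEnd (x : ℕ) : blockPos hR x < blockEnd hR x := by
  have := blockStart_le (R := R) x
  have := lt_blockEnd hR x
  unfold blockPos; split_ifs <;> omega

theorem blockPos_zero : blockPos hR 0 = 0 := by
  simp [blockPos, blockStart_zero]

theorem blockPos_blockSucc (x : ℕ) : blockPos hR (blockSucc R x) = blockPos hR x + 1 := by
  have h₁ := blockStart_le (R := R) x
  have h₂ := blockStart_mod_two (R := R) x
  have h₃ := lt_blockEnd hR x
  have h₄ := blockEnd_mod_two hR x
  have hsame {y : ℕ} (hs : blockStart R x ≤ y) (hy : y < blockEnd hR x) :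
      blockStart R y = blockStart R x ∧ blockEnd hR y = blockEnd hR x := by
    have he := blockEnd_eq_of_blockStart_eq hR (blockStart_blockStart (R := R) x)
    rw [← he] at hy
    exact ⟨(blockStart_eq_of_lt_blockEnd hR hs hy).trans (blockStart_blockStart x),
      (blockEnd_eq_of_lt_blockEnd hR hs hy).trans he⟩
  have hend {y : ℕ} (hy : x < y) (hye : y ≤ blockEnd hR x) :
      blockStart R y = y ↔ y = blockEnd hR x :=
    ⟨fun h => le_antisymm hye (blockEnd_le hR hy h), fun h => h ▸ blockStart_blockEnd hR x⟩
  unfold blockSucc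
  by_cases hx : x % 2 = 0
  · simp only [if_pos hx, hend (y := x + 2) (by omega) (by omega)]
    split_ifs with h
    · obtain ⟨h₅, h₆⟩ := hsame (y := blockStart R x + 1) (by omega) (by omega)
      rw [blockPos, blockPos, h₆, if_neg (by omega), if_pos hx]
      omega
    · obtain ⟨h₅, h₆⟩ := hsame (y := x + 2) (by omega) (by omega)
      rw [blockPos, blockPos, h₅, if_pos (by omega), if_pos hx]
      omega
  · simp only [if_neg hx, hend (y := x + 1) (by omega) (by omega)]
    split_ifs with h
    · rw [blockPos, blockPos, h, blockStart_blockEnd, if_pos h₄, if_neg hx]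
      omega
    · obtain ⟨h₅, h₆⟩ := hsame (y := x + 2) (by omega) (by omega)
      rw [blockPos, blockPos, h₆, if_neg (by omega), if_neg hx]
      omega

theorem blockPos_le_iff (x y : ℕ) : blockPos hR x ≤ blockPos hR y ↔ BlockLE R x y := by
  have hlt {x y : ℕ} (h : blockStart R x < blockStart R y) : blockPos hR x < blockPos hR y :=
    (blockPos_lt_blockEnd hR x).trans_le
      ((blockEnd_le_blockStart hR h).trans (blockStart_le_blockPos hR y))
  unfold BlockLE
  rcases lt_trichotomy (blockStart R x) (blockStart R y) with h | h | h
  · exact iff_of_true (hlt h).le (Or.inl h)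
  · have h₁ := blockStart_le (R := R) x
    have h₂ := blockStart_mod_two (R := R) x
    have h₃ := lt_blockEnd hR x
    have h₄ := blockEnd_mod_two hR x
    have h₅ := blockEnd_eq_of_blockStart_eq hR h
    have h₆ := blockStart_le (R := R) y
    have h₇ := lt_blockEnd hR y
    unfold blockPos
    split_ifs <;> omega
  · exact iff_of_false (hlt h).not_ge (by omega)

theorem blockPos_injective : Function.Injective (blockPos hR) := by
  intro x y h
  have h₁ := (blockPos_le_iff hR x y).1 h.le
  have h₂ := (blockPos_le_iff hR y x).1 h.ge
  unfold BlockLE at h₁ h₂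
  omega

theorem blockPos_iterate (n : ℕ) : blockPos hR ((blockSucc R)^[n] 0) = n := by
  induction n with
  | zero => exact blockPos_zero hR
  | succ n ih => rw [Function.iterate_succ_apply', blockPos_blockSucc, ih]

/-- The enumeration of `ℕ` along `BlockLE R`. -/
def blockEquiv : ℕ ≃ ℕ where
  toFun n := (blockSucc R)^[n] 0
  invFun := blockPos hR
  left_inv := blockPos_iterate hR
  right_inv _ := blockPos_injective hR (blockPos_iterate hR _)

theorem blockEquiv_symm_add_one (x : ℕ) :
    blockEquiv hR ((blockEquiv hR).symm x + 1) = blockSucc R x := by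
  rw [← Equiv.eq_symm_apply]
  exact (blockPos_blockSucc hR x).symm

/-- If `g` stays below the ends of late blocks, it cannot be a conjugate of a function that is
eventually at least `2 * x`. -/
theorem conj_ne_of_lt_of_rel {g f : ℕ → ℕ}
    (hg : ∀ᶠ a in atTop, ∀ k, R a k → g (a + 1) < k) (hf : ∀ᶠ x in atTop, 2 * x ≤ f x) :
    g ≠ fun x => blockEquiv hR (f ((blockEquiv hR).symm x)) := by
  intro h
  obtain ⟨m, hm⟩ := eventually_atTop.1 (hg.and hf)
  obtain ⟨a, hma, ha⟩ := exists_boundary_gt hR m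
  have h₁ := lt_blockEnd hR a
  have h₂ := blockEnd_mod_two hR a
  have h₃ := blockStart_mod_two (R := R) a
  have h₄ : a + 1 < blockEnd hR a := by omega
  have hpos : blockPos hR (a + 1) = (blockEnd hR a + (a + 1)) / 2 := by
    rw [blockPos, if_neg (by omega), blockEnd_eq_of_lt_blockEnd hR (by omega) h₄]
  have hgb : g (a + 1) < blockEnd hR a := by
    have := rel_blockStart_blockEnd hR a
    rw [ha] at this
    exact (hm a hma.le).1 _ this
  have h₅ : blockPos hR (g (a + 1)) = f (blockPos hR (a + 1)) := by
    rw [h]; exact (blockEquiv hR).symm_apply_apply _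
  have h₆ := blockPos_lt_blockEnd hR (g (a + 1))
  have h₇ := blockEnd_le hR hgb (blockStart_blockEnd hR a)
  have h₈ := (hm (blockPos hR (a + 1)) (by omega)).2
  omega

end Blocks

section Primrec

variable {R : ℕ → ℕ → Prop} [DecidableRel R]

theorem primrec_blockStart (hR : PrimrecRel R) : Primrec (blockStart R) := by
  have hs : Primrec fun p : ℕ × ℕ => p.1 + 1 := Primrec.succ.comp Primrec.fst
  refine Primrec.nat_rec₁ 0 (Primrec.ite (PrimrecPred.and ?_ ?_) hs Primrec.snd)
  · exact Primrec.eq.comp (Primrec.nat_mod.comp hs (Primrec.const 2)) (Primrec.const 0)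
  · exact hR.comp Primrec.snd hs

theorem primrec_blockSucc (hR : PrimrecRel R) : Primrec (blockSucc R) := by
  have hb := primrec_blockStart hR
  have h₁ : Primrec fun x : ℕ => x + 1 := Primrec.succ
  have h₂ : Primrec fun x : ℕ => x + 2 := Primrec.succ.comp Primrec.succ
  refine Primrec.ite ?_ (Primrec.ite ?_ ?_ h₂) (Primrec.ite ?_ h₁ h₂)
  · exact Primrec.eq.comp (Primrec.nat_mod.comp Primrec.id (Primrec.const 2)) (Primrec.const 0)
  · exact Primrec.eq.comp (hb.comp h₂) h₂
  · exact Primrec.succ.comp hb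
  · exact Primrec.eq.comp (hb.comp h₁) h₁

theorem primrecRel_blockLE (hR : PrimrecRel R) : PrimrecRel (BlockLE R) := by
  have hb := primrec_blockStart hR
  have hm : Primrec fun x : ℕ => x % 2 := Primrec.nat_mod.comp Primrec.id (Primrec.const 2)
  have hb₁ := hb.comp (Primrec.fst (α := ℕ) (β := ℕ))
  have hb₂ := hb.comp (Primrec.snd (α := ℕ) (β := ℕ))
  have hm₁ := hm.comp (Primrec.fst (α := ℕ) (β := ℕ))
  have hm₂ := hm.comp (Primrec.snd (α := ℕ) (β := ℕ))
  exact (Primrec.nat_lt.comp hb₁ hb₂).or <| (Primrec.eq.comp hb₁ hb₂).and <|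
    (Primrec.nat_lt.comp hm₁ hm₂).or <| (Primrec.eq.comp hm₁ hm₂).and <|
      Primrec.nat_le.comp Primrec.fst Primrec.snd

end Primrec

open Nat.Partrec in
/-- There is a primitive recursive relation `R` such that the least `k` with `R a k`, as a function
of `a`, eventually dominates each primitive recursive function. -/
theorem exists_primrecRel_dominating : ∃ R : ℕ → ℕ → Prop, PrimrecRel R ∧
    (∀ a, ∀ᶠ k in atTop, R a k) ∧
    ∀ g : ℕ → ℕ, Primrec g → ∀ᶠ a in atTop, ∀ k, R a k → g a < k := by
  have hc : Computable fun n => ack n n := computable₂_ack.comp Computable.id Computable.id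
  obtain ⟨e, he⟩ := Code.exists_code.1 (Partrec.nat_iff.1 hc)
  have heval (a v : ℕ) : v ∈ e.eval a ↔ v = ack a a := by
    rw [he]; exact Part.mem_some_iff
  refine ⟨fun a k => (Code.evaln k e a).getD (k + 1) ≤ k, ?_, fun a => ?_, fun g hg => ?_⟩
  · refine Primrec.nat_le.comp (Primrec.option_getD.comp ?_ (Primrec.succ.comp Primrec.snd))
      Primrec.snd
    exact Code.primrec_evaln.comp
      ((Primrec.snd.pair (Primrec.const e)).pair Primrec.fst)
  · obtain ⟨k, hk⟩ := Code.evaln_complete.1 ((heval a _).2 rfl)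
    filter_upwards [eventually_ge_atTop k, eventually_ge_atTop (ack a a)] with n hn hn'
    have := Code.evaln_mono hn hk
    rw [Option.mem_def] at this
    rwa [this]
  · obtain ⟨m, hm⟩ := exists_lt_ack_of_nat_primrec (Primrec.nat_iff.1 hg)
    filter_upwards [eventually_ge_atTop m] with a ha k hk
    cases h : Code.evaln k e a with
    | none => simp [h] at hk
    | some v =>
      rw [h, Option.getD_some, (heval a v).1 (Code.evaln_sound h)] at hk
      exact ((hm a).trans_le (ack_le_ack ha le_rfl)).trans_le hk

theorem stmt_1 : ∃ c : ℕ ≃ ℕ,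
    Primrec (fun x => c (c.symm x + 1)) ∧
    PrimrecRel (fun x y : ℕ => c.symm x ≤ c.symm y) ∧
    ∀ f : ℕ → ℕ, Primrec f → (∀ᶠ x in Filter.atTop, 2 * x ≤ f x) →
      ¬ Primrec (fun x => c (f (c.symm x))) := by
  classical
  obtain ⟨R, hprim, hR, hdom⟩ := exists_primrecRel_dominating
  refine ⟨blockEquiv hR, ?_, ?_, fun f _ hf hg => ?_⟩
  · exact (primrec_blockSucc hprim).of_eq fun x => (blockEquiv_symm_add_one hR x).symm
  · exact (primrecRel_blockLE hprim).of_eq fun x y => (blockPos_le_iff hR x y).symm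
  · exact conj_ne_of_lt_of_rel hR (hdom _ (hg.comp Primrec.succ)) hf rfl
end

section
/- There exists a bijection c : ℕ ≃ ℕ such that: (1) c ∘ S ∘ c⁻¹ is primitive recursive (where S x = x + 1); (2) the binary relation (x, y) ↦ (c⁻¹ x ≤ c⁻¹ y) is primitive recursive; (3) the binary function (x, y) ↦ c (c⁻¹ x + c⁻¹ y) is primitive recursive; and (4) for every primitive recursive function f : ℕ → ℕ satisfying x² ≤ f x for all sufficiently large x, the conjugate c ∘ f ∘ c⁻¹ is not primitive recursive. -/
/-! ### Primitive recursive truncations of fast-growing functions -/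

/-- Every computable function has a majorant whose truncations are primitive recursive. -/
theorem Computable.exists_majorant_primrec_min {g : ℕ → ℕ} (hg : Computable g) :
    ∃ h : ℕ → ℕ, (∀ n, g n ≤ h n) ∧ Primrec₂ fun x n => min x (h n) := by
  obtain ⟨c, hc⟩ := Nat.Partrec.Code.exists_code.1 (Partrec.nat_iff.1 hg.partrec)
  have hex : ∀ n, ∃ t, ∃ y < t, Nat.Partrec.Code.evaln t c n = some y := by
    intro n
    have h1 : g n ∈ c.eval n := by rw [hc]; simp
    obtain ⟨k, hk⟩ := Nat.Partrec.Code.evaln_complete.1 h1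
    exact ⟨k + g n + 1, g n, by omega, Nat.Partrec.Code.evaln_mono (by omega) hk⟩
  classical
  have hR : PrimrecRel fun n t => ∃ y < t, Nat.Partrec.Code.evaln t c n = some y := by
    have h1 : PrimrecRel fun (y a : ℕ) =>
        Nat.Partrec.Code.evaln a.unpair.2 c a.unpair.1 = some y := by
      have hu : Primrec fun a : ℕ × ℕ => a.2.unpair := Primrec.unpair.comp Primrec.snd
      exact Primrec.eq.comp (Nat.Partrec.Code.primrec_evaln.comp
        (((Primrec.snd.comp hu).pair (Primrec.const c)).pair (Primrec.fst.comp hu)))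
        (Primrec.option_some.comp Primrec.fst)
    refine (h1.exists_lt.comp Primrec.snd
      (Primrec₂.natPair.comp Primrec.fst Primrec.snd)).of_eq fun a => ?_
    simp only [Nat.unpair_pair]
  refine ⟨fun n => Nat.find (hex n), fun n => ?_, ?_⟩
  · obtain ⟨y, hy, he⟩ := Nat.find_spec (hex n)
    have h1 := Nat.Partrec.Code.evaln_sound he
    rw [hc] at h1
    have h2 : y = g n := by simpa using h1
    dsimp only
    omega
  · have hrec : Primrec₂ fun (n x : ℕ) => (Nat.rec 0 (fun _ r =>
        if ∃ y < r, Nat.Partrec.Code.evaln r c n = some y then r else r + 1) x : ℕ) := by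
      refine Primrec.nat_rec (g := fun n a =>
        if ∃ y < a.2, Nat.Partrec.Code.evaln a.2 c n = some y then a.2 else a.2 + 1)
        (Primrec.const 0) ?_
      refine Primrec.ite (hR.comp Primrec.fst (Primrec.snd.comp Primrec.snd))
        (Primrec.snd.comp Primrec.snd) (Primrec.succ.comp (Primrec.snd.comp Primrec.snd))
    refine hrec.swap.of_eq fun x n => ?_
    dsimp only [Function.swap]
    induction x with
    | zero => simp
    | succ x ih =>
      simp only [ih]
      split_ifs with h
      · have := Nat.find_min' (hex n) h
        omega
      · have h1 : min x (Nat.find (hex n)) ≠ Nat.find (hex n) := by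
          intro h2
          rw [h2] at h
          exact h (Nat.find_spec (hex n))
        omega

/-- There is a sequence of radices with primitive recursive truncations which outgrows the
diagonal of the Ackermann function along its own partial products. -/
theorem exists_radix_ack_le :
    ∃ b : ℕ → ℕ, (∀ k, 2 ≤ b k) ∧ (Primrec₂ fun x k => min x (b k)) ∧
      ∀ k, ack (∏ i ∈ Finset.range k, b i) (∏ i ∈ Finset.range k, b i) ≤ b k := by
  have hg : Computable fun n => ack n n + 2 :=
    (Primrec.nat_add.to_comp).comp (computable₂_ack.comp Computable.id Computable.id)
      (Computable.const 2)
  obtain ⟨h, hle, hmin⟩ := hg.exists_majorant_primrec_min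
  have hself : ∀ n, n ≤ h n := fun n => by
    have h1 := lt_ack_left n n
    have h2 := hle n
    omega
  let N : ℕ → ℕ := fun k => Nat.rec 1 (fun _ n => n * h n) k
  have hNs : ∀ k, N (k + 1) = N k * h (N k) := fun k => rfl
  have hNpos : ∀ k, 1 ≤ N k := by
    intro k
    induction k with
    | zero => exact le_rfl
    | succ k ih =>
      rw [hNs]
      exact Nat.mul_pos ih (ih.trans (hself _))
  have hprod : ∀ k, ∏ i ∈ Finset.range k, h (N i) = N k := by
    intro k
    induction k with
    | zero => rfl
    | succ k ih => rw [Finset.prod_range_succ, ih, hNs]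
  refine ⟨fun k => h (N k), fun k => ?_, ?_, fun k => ?_⟩
  · exact le_trans (by omega) (hle (N k))
  · have hT : Primrec₂ fun (x k : ℕ) => min x (N k) := by
      have hrec : Primrec₂ fun (x k : ℕ) => (Nat.rec (min x 1) (fun _ r =>
          if r = x then x else min x (r * min x (h r))) k : ℕ) := by
        have hr : Primrec fun a : ℕ × ℕ × ℕ => a.2.2 := Primrec.snd.comp Primrec.snd
        refine Primrec.nat_rec (f := fun x => min x 1)
          (g := fun x a => if a.2 = x then x else min x (a.2 * min x (h a.2)))
          (Primrec.nat_min.comp Primrec.id (Primrec.const 1)) ?_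
        exact Primrec.ite (Primrec.eq.comp hr Primrec.fst) Primrec.fst
          (Primrec.nat_min.comp Primrec.fst (Primrec.nat_mul.comp hr (hmin.comp Primrec.fst hr)))
      refine hrec.of_eq fun x k => ?_
      induction k with
      | zero => rfl
      | succ k ih =>
        have hN := hNpos k
        simp only [ih, hNs]
        split_ifs with hx
        · have h1 : N k ≤ N k * h (N k) := Nat.le_mul_of_pos_right _ (hN.trans (hself _))
          omega
        · have h1 : min x (N k) = N k := by omega
          rw [h1]
          rcases le_total x (h (N k)) with h2 | h2
          · rw [min_eq_left h2]
            have h3 : x ≤ N k * x := Nat.le_mul_of_pos_left _ hN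
            have h4 : N k * x ≤ N k * h (N k) := Nat.mul_le_mul_left _ h2
            omega
          · rw [min_eq_right h2]
    have hB : Primrec₂ fun (x k : ℕ) =>
        if min x (N k) = x then x else min x (h (min x (N k))) :=
      Primrec.ite (Primrec.eq.comp hT Primrec.fst) Primrec.fst (hmin.comp Primrec.fst hT)
    refine hB.of_eq fun x k => ?_
    split_ifs with hx
    · have := hself (N k)
      dsimp only
      omega
    · have h1 : min x (N k) = N k := by omega
      rw [h1]
  · simp only [hprod]
    exact le_trans (by omega) (hle (N k))

/-! ### Recursion with parameter substitution -/

/-- Recursion on `n` in which the parameter is updated by `next` at every step. -/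
def substRec {σ : Type*} (next : σ → σ) (out : ℕ → σ → ℕ) (z : ℕ) : ℕ → σ → ℕ
  | 0, _ => z
  | n + 1, s => out (substRec next out z n (next s)) s

theorem primrec₂_substRec {σ : Type*} [Primcodable σ] {next : σ → σ} {out : ℕ → σ → ℕ} {z : ℕ}
    (hnext : Primrec next) (hout : Primrec₂ out) : Primrec₂ (substRec next out z) := by
  have hrec : Primrec₂ fun (a : ℕ × σ) (j : ℕ) => (Nat.rec z (fun j r =>
      out r (next^[a.1 - (j + 1)] a.2)) j : ℕ) := by
    refine Primrec.nat_rec (f := fun _ => z)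
      (g := fun (a : ℕ × σ) (q : ℕ × ℕ) => out q.2 (next^[a.1 - (q.1 + 1)] a.2)) (Primrec.const z) ?_
    refine hout.comp (Primrec.snd.comp Primrec.snd) ?_
    refine Primrec.nat_iterate ?_ (Primrec.snd.comp Primrec.fst) (hnext.comp Primrec.snd)
    exact Primrec.nat_sub.comp (Primrec.fst.comp Primrec.fst)
      (Primrec.succ.comp (Primrec.fst.comp Primrec.snd))
  have hspec : ∀ n s j, j ≤ n → (Nat.rec z (fun j r =>
      out r (next^[n - (j + 1)] s)) j : ℕ) = substRec next out z j (next^[n - j] s) := by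
    intro n s j hj
    induction j with
    | zero => rfl
    | succ j ih =>
      simp only [ih (by omega), substRec]
      rw [← Function.iterate_succ_apply' next]
      congr 3
      omega
  refine (hrec.comp (Primrec.id) Primrec.fst).of_eq fun a => ?_
  simpa using hspec a.1 a.2 a.1 le_rfl

/-! ### Primitive recursive enumerations -/

theorem Primrec.nat_count {p : ℕ → Prop} [DecidablePred p] (hp : PrimrecPred p) :
    Primrec (Nat.count p) := by
  refine (Primrec.nat_rec₁ (f := fun n r => r + if p n then 1 else 0) 0 ?_).of_eq fun n => ?_
  · exact Primrec.nat_add.comp Primrec.snd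
      (Primrec.ite (hp.comp Primrec.fst) (Primrec.const 1) (Primrec.const 0))
  · induction n with
    | zero => simp
    | succ n ih => simp only [ih, Nat.count_succ]

theorem Primrec.nat_nth {p : ℕ → Prop} (hp : PrimrecPred p) {g : ℕ → ℕ} (hg : Primrec g)
    (hmono : StrictMono g) (hmem : ∀ i, p (g i)) : Primrec (Nat.nth p) := by
  classical
  have hinf : (Set.ofPred p).Infinite :=
    Set.infinite_of_injective_forall_mem hmono.injective hmem
  have hcount : ∀ i, i ≤ Nat.count p (g i) :=
    fun _ => StrictMono.le_apply (f := fun i => Nat.count p (g i))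
      fun i j hij => Nat.count_strict_mono (hmem i) (hmono hij)
  refine Primrec.of_graph ⟨g, hg, fun i => ?_⟩ ?_
  · rw [Encodable.encode_nat]
    by_contra! h
    have h1 := Nat.count_strict_mono (hmem i) h
    rw [Nat.count_nth_of_infinite hinf] at h1
    have := hcount i
    omega
  · have h1 : PrimrecRel fun i m => p m ∧ Nat.count p m = i :=
      (hp.comp Primrec.snd).and (Primrec.eq.comp ((Primrec.nat_count hp).comp Primrec.snd)
        Primrec.fst)
    refine h1.of_eq fun i m => ⟨?_, ?_⟩
    · rintro ⟨h2, rfl⟩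
      exact Nat.nth_count h2
    · rintro rfl
      exact ⟨Nat.nth_mem_of_infinite hinf i, Nat.count_nth_of_infinite hinf i⟩

/-! ### Mixed radix numerals

A natural number `x` codes the finitely supported digit sequence whose first digit is
`x.unpair.2` and whose remaining digits are coded by `x.unpair.1`. -/

namespace MixedRadix

theorem unpair_fst_le {x n : ℕ} (h : x ≤ n + 1) : x.unpair.1 ≤ n := by
  rcases Nat.eq_zero_or_pos x with rfl | hx
  · simp
  · have := Nat.unpair_lt hx
    omega

/-- The `i`-th digit of the sequence coded by `x`. -/
def digit (x i : ℕ) : ℕ := ((fun y : ℕ => y.unpair.1)^[i] x).unpair.2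

theorem digit_succ (x i : ℕ) : digit x (i + 1) = digit x.unpair.1 i := rfl

theorem digit_eq_zero {x i : ℕ} (h : x ≤ i) : digit x i = 0 := by
  induction i generalizing x with
  | zero =>
    obtain rfl : x = 0 := by omega
    simp [digit]
  | succ i ih => exact ih (unpair_fst_le h)

theorem primrec₂_digit : Primrec₂ digit :=
  Primrec.snd.comp (Primrec.unpair.comp (Primrec.nat_iterate Primrec.snd Primrec.fst
    (Primrec.fst.comp (Primrec.unpair.comp Primrec.snd))))

variable (b : ℕ → ℕ)

/-- The digits coded by `x` are legal when read from position `k` on. -/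
def Valid (k x : ℕ) : Prop := ∀ i, digit x i < b (k + i)

theorem valid_iff {k x : ℕ} : Valid b k x ↔ x.unpair.2 < b k ∧ Valid b (k + 1) x.unpair.1 := by
  constructor
  · intro h
    refine ⟨h 0, fun i => ?_⟩
    have := h (i + 1)
    rwa [digit_succ, show k + (i + 1) = k + 1 + i by omega] at this
  · rintro ⟨h, h'⟩ (_ | i)
    · exact h
    · have := h' i
      rwa [show k + 1 + i = k + (i + 1) by omega] at this

/-- The number denoted by `x`, in units of the `k`-th place value. -/
def value (k x : ℕ) : ℕ :=
  if _ : x = 0 then 0 else x.unpair.2 + b k * value (k + 1) x.unpair.1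
termination_by x
decreasing_by exact Nat.unpair_lt (by omega)

theorem value_zero (k : ℕ) : value b k 0 = 0 := by rw [value]; simp

theorem value_eq (k x : ℕ) :
    value b k x = x.unpair.2 + b k * value b (k + 1) x.unpair.1 := by
  by_cases h : x = 0
  · subst h
    simp [value_zero]
  · rw [value, dif_neg h]

/-- The numeral of the `k`-th place value. -/
def place (k : ℕ) : ℕ := Nat.rec 1 (fun _ r => Nat.pair r 0) k

theorem place_succ (k : ℕ) : place (k + 1) = Nat.pair (place k) 0 := rfl

theorem primrec_place : Primrec place :=
  Primrec.nat_rec₁ 1 (Primrec₂.natPair.comp (Primrec.snd) (Primrec.const 0))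

theorem place_strictMono : StrictMono place := by
  have hpos : ∀ k, 1 ≤ place k := by
    intro k
    induction k with
    | zero => exact le_rfl
    | succ k ih => exact ih.trans (Nat.left_le_pair _ _)
  refine strictMono_nat_of_lt_succ fun k => ?_
  have h := Nat.unpair_lt ((hpos (k + 1)))
  simpa [place_succ] using h

/-- The state of digitwise addition: position, carry, and the two remaining numerals. -/
abbrev AddState := ℕ × ℕ × ℕ × ℕ

/-- The sum of the current digits and the carry. -/
def AddState.digitSum (s : AddState) : ℕ := s.2.2.1.unpair.2 + s.2.2.2.unpair.2 + s.2.1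

/-- One step of digitwise addition. -/
def AddState.next (s : AddState) : AddState :=
  (s.1 + 1, if s.digitSum < b s.1 then 0 else 1, s.2.2.1.unpair.1, s.2.2.2.unpair.1)

/-- Addition of numerals by digitwise addition with carry. -/
def add (x y : ℕ) : ℕ :=
  substRec (AddState.next b) (fun r s => Nat.pair r
    (if s.digitSum < b s.1 then s.digitSum else s.digitSum - b s.1)) 0 (x + y + 1) (0, 0, x, y)

/-- Comparison of numerals, most significant digit first. -/
def leCode (x y : ℕ) : ℕ :=
  substRec (fun s : ℕ × ℕ => (s.1.unpair.1, s.2.unpair.1))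
    (fun r s => if s.1.unpair.1 = s.2.unpair.1 then
      (if s.1.unpair.2 ≤ s.2.unpair.2 then 1 else 0) else r) 1 (x + y) (x, y)

theorem primrec₂_leCode : Primrec₂ leCode := by
  have h1 : Primrec fun a : ℕ × ℕ × ℕ => a.2.1.unpair :=
    Primrec.unpair.comp (Primrec.fst.comp Primrec.snd)
  have h2 : Primrec fun a : ℕ × ℕ × ℕ => a.2.2.unpair :=
    Primrec.unpair.comp (Primrec.snd.comp Primrec.snd)
  refine (primrec₂_substRec ?_ ?_).comp (Primrec.nat_add.comp Primrec.fst Primrec.snd)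
    (Primrec.fst.pair Primrec.snd)
  · exact (Primrec.fst.comp (Primrec.unpair.comp Primrec.fst)).pair
      (Primrec.fst.comp (Primrec.unpair.comp Primrec.snd))
  · exact Primrec.ite (Primrec.eq.comp (Primrec.fst.comp h1) (Primrec.fst.comp h2))
      (Primrec.ite (Primrec.nat_le.comp (Primrec.snd.comp h1) (Primrec.snd.comp h2))
        (Primrec.const 1) (Primrec.const 0)) Primrec.fst

variable {b}

theorem primrec₂_sub_radix (hmin : Primrec₂ fun x k => min x (b k)) :
    Primrec₂ fun x k => x - b k :=
  (Primrec.nat_sub.comp Primrec.fst hmin).of_eq fun a => by dsimp only; omega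

theorem primrecRel_lt_radix (hmin : Primrec₂ fun x k => min x (b k)) :
    PrimrecRel fun x k => x < b k :=
  (Primrec.eq.comp (hmin.comp (Primrec.succ.comp Primrec.fst) Primrec.snd)
    (Primrec.succ.comp Primrec.fst)).of_eq fun a => by dsimp only; omega

theorem primrec₂_add (hmin : Primrec₂ fun x k => min x (b k)) : Primrec₂ (add b) := by
  have hx : Primrec fun s : AddState => s.2.2.1.unpair :=
    Primrec.unpair.comp (Primrec.fst.comp (Primrec.snd.comp Primrec.snd))
  have hy : Primrec fun s : AddState => s.2.2.2.unpair :=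
    Primrec.unpair.comp (Primrec.snd.comp (Primrec.snd.comp Primrec.snd))
  have hsum : Primrec AddState.digitSum :=
    Primrec.nat_add.comp (Primrec.nat_add.comp (Primrec.snd.comp hx) (Primrec.snd.comp hy))
      (Primrec.fst.comp Primrec.snd)
  have hlt : PrimrecPred fun s : AddState => s.digitSum < b s.1 :=
    (primrecRel_lt_radix hmin).comp hsum Primrec.fst
  refine (primrec₂_substRec ?_ ?_).comp
    (Primrec.succ.comp (Primrec.nat_add.comp Primrec.fst Primrec.snd))
    ((Primrec.const 0).pair ((Primrec.const 0).pair (Primrec.fst.pair Primrec.snd)))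
  · exact (Primrec.succ.comp Primrec.fst).pair
      ((Primrec.ite hlt (Primrec.const 0) (Primrec.const 1)).pair
        ((Primrec.fst.comp hx).pair (Primrec.fst.comp hy)))
  · exact Primrec₂.natPair.comp Primrec.fst (Primrec.ite (hlt.comp Primrec.snd)
      (hsum.comp Primrec.snd) (((primrec₂_sub_radix hmin).comp hsum Primrec.fst).comp Primrec.snd))


theorem substRec_add_spec (hb : ∀ k, 2 ≤ b k) (n k c x y : ℕ) (hc : c ≤ 1) (hx : x ≤ n)
    (hy : y ≤ n) (hvx : Valid b k x) (hvy : Valid b k y) :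
    Valid b k (substRec (AddState.next b) (fun r s => Nat.pair r
      (if s.digitSum < b s.1 then s.digitSum else s.digitSum - b s.1)) 0 (n + 1) (k, c, x, y)) ∧
    value b k (substRec (AddState.next b) (fun r s => Nat.pair r
      (if s.digitSum < b s.1 then s.digitSum else s.digitSum - b s.1)) 0 (n + 1) (k, c, x, y)) =
      value b k x + value b k y + c := by
  induction n generalizing k c x y with
  | zero =>
    obtain rfl : x = 0 := by omega
    obtain rfl : y = 0 := by omega
    have hcb : AddState.digitSum (k, c, 0, 0) < b k := by
      have := hb k
      simp only [AddState.digitSum, Nat.unpair_zero, Prod.snd_zero]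
      omega
    rw [valid_iff, value_eq]
    simp only [substRec, hcb, if_true, Nat.unpair_pair, value_zero]
    exact ⟨⟨trivial, ((valid_iff b).1 hvx).2⟩, by simp [AddState.digitSum]⟩
  | succ n ih =>
    obtain ⟨hdx, hvx'⟩ := (valid_iff b).1 hvx
    obtain ⟨hdy, hvy'⟩ := (valid_iff b).1 hvy
    have hs : AddState.digitSum (k, c, x, y) = x.unpair.2 + y.unpair.2 + c := rfl
    rw [substRec, valid_iff, value_eq b k x, value_eq b k y, value_eq]
    by_cases h : AddState.digitSum (k, c, x, y) < b k
    · obtain ⟨h1, h2⟩ := ih (k + 1) 0 x.unpair.1 y.unpair.1 (by omega) (unpair_fst_le hx)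
        (unpair_fst_le hy) hvx' hvy'
      simp only [Nat.unpair_pair, AddState.next, h, if_true]
      refine ⟨⟨trivial, h1⟩, ?_⟩
      rw [h2, hs]
      ring
    · obtain ⟨h1, h2⟩ := ih (k + 1) 1 x.unpair.1 y.unpair.1 (by omega) (unpair_fst_le hx)
        (unpair_fst_le hy) hvx' hvy'
      simp only [Nat.unpair_pair, AddState.next, h, if_false]
      refine ⟨⟨by omega, h1⟩, ?_⟩
      rw [h2, mul_add, mul_add]
      omega

theorem valid_add (hb : ∀ k, 2 ≤ b k) {x y : ℕ} (hx : Valid b 0 x) (hy : Valid b 0 y) :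
    Valid b 0 (add b x y) :=
  (substRec_add_spec hb (x + y) 0 0 x y (by omega) (by omega) (by omega) hx hy).1

theorem value_add (hb : ∀ k, 2 ≤ b k) {x y : ℕ} (hx : Valid b 0 x) (hy : Valid b 0 y) :
    value b 0 (add b x y) = value b 0 x + value b 0 y :=
  (substRec_add_spec hb (x + y) 0 0 x y (by omega) (by omega) (by omega) hx hy).2

theorem eq_of_value_eq {k x y : ℕ} (hx : Valid b k x) (hy : Valid b k y)
    (h : value b k x = value b k y) : x = y := by
  obtain ⟨n, hxn, hyn⟩ : ∃ n, x ≤ n ∧ y ≤ n := ⟨x + y, by omega, by omega⟩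
  induction n generalizing k x y with
  | zero => omega
  | succ n ih =>
    obtain ⟨hdx, hvx⟩ := (valid_iff b).1 hx
    obtain ⟨hdy, hvy⟩ := (valid_iff b).1 hy
    rw [value_eq b k x, value_eq b k y] at h
    have hpos : 0 < b k := by omega
    have h1 : x.unpair.2 = y.unpair.2 := by
      have := congrArg (· % b k) h
      simpa [Nat.mod_eq_of_lt hdx, Nat.mod_eq_of_lt hdy] using this
    have h2 : value b (k + 1) x.unpair.1 = value b (k + 1) y.unpair.1 := by
      rw [h1] at h
      exact Nat.eq_of_mul_eq_mul_left hpos (by omega)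
    have h3 := ih hvx hvy h2 (unpair_fst_le hxn) (unpair_fst_le hyn)
    rw [← Nat.pair_unpair x, ← Nat.pair_unpair y, h1, h3]

theorem exists_valid_value_eq (hb : ∀ k, 2 ≤ b k) (n k : ℕ) :
    ∃ x, Valid b k x ∧ value b k x = n := by
  induction n using Nat.strong_induction_on generalizing k with
  | _ n ih =>
    rcases Nat.eq_zero_or_pos n with rfl | hn
    · exact ⟨0, fun i => by rw [digit_eq_zero (by omega)]; have := hb (k + i); omega,
        value_zero b k⟩
    · obtain ⟨x, hx, hv⟩ := ih (n / b k) (Nat.div_lt_self hn (hb k)) (k + 1)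
      refine ⟨Nat.pair x (n % b k), ?_, ?_⟩
      · rw [valid_iff]
        simp only [Nat.unpair_pair]
        exact ⟨Nat.mod_lt _ (by have := hb k; omega), hx⟩
      · rw [value_eq]
        simp only [Nat.unpair_pair, hv]
        exact Nat.mod_add_div n (b k)

theorem leCode_eq_one_iff {x y : ℕ} (hx : Valid b 0 x) (hy : Valid b 0 y) :
    leCode x y = 1 ↔ value b 0 x ≤ value b 0 y := by
  have key : ∀ n k x y, x ≤ n → y ≤ n → Valid b k x → Valid b k y →
      (substRec (fun s : ℕ × ℕ => (s.1.unpair.1, s.2.unpair.1))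
        (fun r s => if s.1.unpair.1 = s.2.unpair.1 then
          (if s.1.unpair.2 ≤ s.2.unpair.2 then 1 else 0) else r) 1 n (x, y) = 1 ↔
        value b k x ≤ value b k y) := by
    intro n
    induction n with
    | zero =>
      intro k x y hx hy _ _
      obtain rfl : x = 0 := by omega
      obtain rfl : y = 0 := by omega
      simp [substRec]
    | succ n ih =>
      intro k x y hxn hyn hx hy
      obtain ⟨hdx, hvx⟩ := (valid_iff b).1 hx
      obtain ⟨hdy, hvy⟩ := (valid_iff b).1 hy
      rw [substRec, value_eq b k x, value_eq b k y]
      dsimp only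
      split_ifs with h h'
      · simp [h, h']
      · simp [h, h']
      · rw [ih (k + 1) _ _ (unpair_fst_le hxn) (unpair_fst_le hyn) hvx hvy]
        rcases lt_trichotomy (value b (k + 1) x.unpair.1) (value b (k + 1) y.unpair.1)
          with h1 | h1 | h1
        · refine iff_of_true h1.le ?_
          have := Nat.mul_le_mul_left (b k) (Nat.succ_le_of_lt h1)
          rw [Nat.mul_succ] at this
          omega
        · exact absurd (eq_of_value_eq hvx hvy h1) h
        · refine iff_of_false (by omega) ?_
          have := Nat.mul_le_mul_left (b k) (Nat.succ_le_of_lt h1)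
          rw [Nat.mul_succ] at this
          omega
  exact key (x + y) 0 x y (by omega) (by omega) hx hy

theorem primrecPred_valid (hb : ∀ k, 2 ≤ b k) (hmin : Primrec₂ fun x k => min x (b k)) :
    PrimrecPred (Valid b 0) := by
  have h1 : PrimrecRel fun i x => digit x i < b i :=
    (primrecRel_lt_radix hmin).comp (primrec₂_digit.comp Primrec.snd Primrec.fst) Primrec.fst
  refine (PrimrecRel.comp (f := fun x : ℕ => x) (g := fun x : ℕ => x)
    h1.forall_lt Primrec.id Primrec.id).of_eq fun x => ⟨fun h i => ?_, fun h i _ => ?_⟩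
  · rw [zero_add]
    rcases lt_or_ge i x with hi | hi
    · exact h i hi
    · rw [digit_eq_zero hi]
      have := hb i
      omega
  · simpa using h i

theorem valid_place (hb : ∀ k, 2 ≤ b k) (j k : ℕ) : Valid b j (place k) := by
  induction k generalizing j with
  | zero =>
    intro i
    rcases i with _ | i
    · have : digit 1 0 = 1 := by decide
      exact this ▸ hb _
    · have h0 : digit (place 0) (i + 1) = 0 := digit_eq_zero (show 1 ≤ i + 1 by omega)
      rw [h0]
      have := hb (j + (i + 1))
      omega
  | succ k ih =>
    rw [valid_iff, place_succ, Nat.unpair_pair]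
    exact ⟨by have := hb j; dsimp only; omega, ih _⟩

theorem prod_range_radix_succ (b : ℕ → ℕ) (j k : ℕ) :
    ∏ i ∈ Finset.range (k + 1), b (j + i) = b j * ∏ i ∈ Finset.range k, b (j + 1 + i) := by
  rw [Finset.prod_range_succ', mul_comm]
  simp only [add_zero, add_assoc, add_comm 1]

theorem value_place (j k : ℕ) : value b j (place k) = ∏ i ∈ Finset.range k, b (j + i) := by
  induction k generalizing j with
  | zero =>
    have h1 : Nat.unpair 1 = (0, 1) := by decide
    rw [value_eq, show place 0 = 1 from rfl, h1]
    simp [value_zero]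
  | succ k ih =>
    rw [value_eq, place_succ, prod_range_radix_succ, Nat.unpair_pair]
    simp [ih]

/-- A number below the next place value is at most its numeral times the current place value. -/
theorem value_lt_mul_place {j x : ℕ} (n : ℕ) (hx : Valid b j x)
    (h : value b j x < ∏ i ∈ Finset.range (n + 1), b (j + i)) :
    value b j x < (x + 1) * ∏ i ∈ Finset.range n, b (j + i) := by
  obtain ⟨hd, hv⟩ := (valid_iff b).1 hx
  have hr := Nat.unpair_right_le x
  have hl := Nat.unpair_left_le x
  induction n generalizing j x with
  | zero =>
    rw [value_eq] at h ⊢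
    have h0 : value b (j + 1) x.unpair.1 = 0 := by
      by_contra hne
      have := Nat.le_mul_of_pos_right (b j) (Nat.pos_of_ne_zero hne)
      simp at h
      omega
    rw [h0]
    simp
    omega
  | succ n ih =>
    obtain ⟨hd', hv'⟩ := (valid_iff b).1 hv
    rw [prod_range_radix_succ, value_eq] at h
    rw [prod_range_radix_succ b j n, value_eq]
    have h1 : value b (j + 1) x.unpair.1 < ∏ i ∈ Finset.range (n + 1), b (j + 1 + i) :=
      Nat.lt_of_mul_lt_mul_left (a := b j) (by omega)
    have h2 := ih hv h1 hd' hv' (Nat.unpair_right_le _) (Nat.unpair_left_le _)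
    calc x.unpair.2 + b j * value b (j + 1) x.unpair.1
        < b j * (value b (j + 1) x.unpair.1 + 1) := by rw [Nat.mul_succ]; omega
      _ ≤ b j * ((x.unpair.1 + 1) * ∏ i ∈ Finset.range n, b (j + 1 + i)) :=
          Nat.mul_le_mul_left _ h2
      _ = (x.unpair.1 + 1) * (b j * ∏ i ∈ Finset.range n, b (j + 1 + i)) := by ring
      _ ≤ (x + 1) * (b j * ∏ i ∈ Finset.range n, b (j + 1 + i)) :=
          Nat.mul_le_mul_right _ (by omega)

theorem infinite_valid (hb : ∀ k, 2 ≤ b k) : (Set.ofPred (Valid b 0)).Infinite :=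
  Set.infinite_of_injective_forall_mem place_strictMono.injective (valid_place hb 0)

theorem bijective_value_nth (hb : ∀ k, 2 ≤ b k) :
    Function.Bijective fun i => value b 0 (Nat.nth (Valid b 0) i) := by
  have hinf := infinite_valid hb
  constructor
  · intro i j hij
    exact Nat.nth_injective hinf (eq_of_value_eq (Nat.nth_mem_of_infinite hinf i)
      (Nat.nth_mem_of_infinite hinf j) hij)
  · intro n
    obtain ⟨x, hx, rfl⟩ := exists_valid_value_eq hb n 0
    classical
    exact ⟨Nat.count (Valid b 0) x, by dsimp only; rw [Nat.nth_count hx]⟩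

/-- The copy of the natural numbers formed by the valid numerals, listed in increasing order of
their codes. -/
noncomputable def copy (hb : ∀ k, 2 ≤ b k) : ℕ ≃ ℕ :=
  (Equiv.ofBijective _ (bijective_value_nth hb)).symm

theorem copy_symm_apply (hb : ∀ k, 2 ≤ b k) (i : ℕ) :
    (copy hb).symm i = value b 0 (Nat.nth (Valid b 0) i) := rfl

open scoped Classical in
theorem copy_value (hb : ∀ k, 2 ≤ b k) {x : ℕ} (hx : Valid b 0 x) :
    copy hb (value b 0 x) = Nat.count (Valid b 0) x := by
  rw [← Equiv.eq_symm_apply, copy_symm_apply, Nat.nth_count hx]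

theorem primrec_nth_valid (hb : ∀ k, 2 ≤ b k) (hmin : Primrec₂ fun x k => min x (b k)) :
    Primrec (Nat.nth (Valid b 0)) :=
  Primrec.nat_nth (primrecPred_valid hb hmin) primrec_place place_strictMono (valid_place hb 0)

theorem primrec₂_copy_add (hb : ∀ k, 2 ≤ b k) (hmin : Primrec₂ fun x k => min x (b k)) :
    Primrec₂ fun x y => copy hb ((copy hb).symm x + (copy hb).symm y) := by
  classical
  have hnth := primrec_nth_valid hb hmin
  refine ((Primrec.nat_count (primrecPred_valid hb hmin)).comp ((primrec₂_add hmin).comp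
    (hnth.comp Primrec.fst) (hnth.comp Primrec.snd))).of_eq fun a => ?_
  have hmem := Nat.nth_mem_of_infinite (infinite_valid hb)
  dsimp only
  rw [copy_symm_apply, copy_symm_apply, ← value_add hb (hmem _) (hmem _),
    copy_value hb (valid_add hb (hmem _) (hmem _))]

theorem primrecRel_copy_le (hb : ∀ k, 2 ≤ b k) (hmin : Primrec₂ fun x k => min x (b k)) :
    PrimrecRel fun x y => (copy hb).symm x ≤ (copy hb).symm y := by
  have hnth := primrec_nth_valid hb hmin
  refine (Primrec.eq.comp (primrec₂_leCode.comp (hnth.comp Primrec.fst) (hnth.comp Primrec.snd))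
    (Primrec.const 1)).of_eq fun a => ?_
  have hmem := Nat.nth_mem_of_infinite (infinite_valid hb)
  exact leCode_eq_one_iff (hmem _) (hmem _)

theorem not_primrec_copy (hb : ∀ k, 2 ≤ b k) (hmin : Primrec₂ fun x k => min x (b k))
    (hack : ∀ k, ack (∏ i ∈ Finset.range k, b i) (∏ i ∈ Finset.range k, b i) ≤ b k)
    {f : ℕ → ℕ} (hf : Primrec f) (hsq : ∀ᶠ x in Filter.atTop, x ^ 2 ≤ f x) :
    ¬ Primrec fun x => copy hb (f ((copy hb).symm x)) := by
  classical
  intro hp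
  set N : ℕ → ℕ := fun k => ∏ i ∈ Finset.range k, b i with hN
  have hNs : ∀ k, N (k + 1) = N k * b k := fun k => Finset.prod_range_succ _ _
  have hNk : ∀ k, k < N k := by
    intro k
    induction k with
    | zero => simp [hN]
    | succ k ih =>
      rw [hNs]
      have := Nat.mul_le_mul_left (N k) (hb k)
      omega
  set P : ℕ → ℕ := fun k => Nat.nth (Valid b 0)
    (copy hb (f ((copy hb).symm (Nat.count (Valid b 0) (place k))))) with hP
  have hPprim : Primrec P := (primrec_nth_valid hb hmin).comp
    (hp.comp ((Primrec.nat_count (primrecPred_valid hb hmin)).comp primrec_place))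
  have hPvalid : ∀ k, Valid b 0 (P k) := fun k => Nat.nth_mem_of_infinite (infinite_valid hb) _
  have hPvalue : ∀ k, value b 0 (P k) = f (N k) := by
    intro k
    have h1 : (copy hb).symm (Nat.count (Valid b 0) (place k)) = N k := by
      rw [← copy_value hb (valid_place hb 0 k), Equiv.symm_apply_apply, value_place]
      simp [hN]
    rw [hP, ← copy_symm_apply hb, Equiv.symm_apply_apply, h1]
  obtain ⟨m₁, hm₁⟩ := exists_lt_ack_of_nat_primrec (Primrec.nat_iff.1 hf)
  obtain ⟨m₂, hm₂⟩ := exists_lt_ack_of_nat_primrec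
    (Primrec.nat_iff.1 (hPprim.comp Primrec.succ))
  obtain ⟨n₀, hn₀⟩ := Filter.eventually_atTop.1 hsq
  set k := m₁ + m₂ + n₀
  have hk := hNk k
  have hkN : N k ≤ N (k + 1) := (Nat.le_mul_of_pos_right _ (by have := hb k; omega)).trans_eq
    (hNs k).symm
  have hm : m₁ ≤ N (k + 1) := by omega
  have hfb : f (N (k + 1)) < b (k + 1) :=
    (hm₁ _).trans_le ((ack_mono_left _ hm).trans (hack (k + 1)))
  have hPb : P (k + 1) < N (k + 1) :=
    calc P (k + 1) < ack m₂ k := hm₂ k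
      _ ≤ ack (N k) (N k) := ack_le_ack (by omega) (by omega)
      _ ≤ b k := hack k
      _ ≤ N (k + 1) := by rw [hNs]; exact Nat.le_mul_of_pos_left _ (by omega)
  have hlt : value b 0 (P (k + 1)) < (P (k + 1) + 1) * N (k + 1) := by
    have h1 := value_lt_mul_place (k + 1) (hPvalid (k + 1)) (by
      simp only [zero_add]
      rw [hPvalue, show ∏ i ∈ Finset.range (k + 1 + 1), b i = N (k + 1) * b (k + 1) from hNs _]
      exact hfb.trans_le (Nat.le_mul_of_pos_left _ (Nat.zero_lt_of_lt (hNk (k + 1)))))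
    simpa [hN] using h1
  rw [hPvalue] at hlt
  have h2 := hn₀ (N (k + 1)) (by omega)
  have h3 : (P (k + 1) + 1) * N (k + 1) ≤ N (k + 1) * N (k + 1) := Nat.mul_le_mul_right _ hPb
  rw [sq] at h2
  omega

end MixedRadix


theorem stmt_2 : ∃ c : ℕ ≃ ℕ,
    Primrec (fun x => c (c.symm x + 1)) ∧
    PrimrecRel (fun x y : ℕ => c.symm x ≤ c.symm y) ∧
    Primrec₂ (fun x y : ℕ => c (c.symm x + c.symm y)) ∧
    ∀ f : ℕ → ℕ, Primrec f → (∀ᶠ x in Filter.atTop, x ^ 2 ≤ f x) →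
      ¬ Primrec (fun x => c (f (c.symm x))) := by
  obtain ⟨b, hb, hmin, hack⟩ := exists_radix_ack_le
  refine ⟨MixedRadix.copy hb, ?_, MixedRadix.primrecRel_copy_le hb hmin,
    MixedRadix.primrec₂_copy_add hb hmin,
    fun f hf hsq => MixedRadix.not_primrec_copy hb hmin hack hf hsq⟩
  refine ((MixedRadix.primrec₂_copy_add hb hmin).comp Primrec.id
    (Primrec.const (MixedRadix.copy hb 1))).of_eq fun x => ?_
  simp
end

section
/- There exists a bijection c : ℕ ≃ ℕ such that: (1) c ∘ S ∘ c⁻¹ is primitive recursive (where S x = x + 1); (2) the binary relation (x, y) ↦ (c⁻¹ x ≤ c⁻¹ y) is primitive recursive; (3) the binary functions (x, y) ↦ c (c⁻¹ x + c⁻¹ y) and (x, y) ↦ c (c⁻¹ x · c⁻¹ y) are primitive recursive; and (4) for every primitive recursive function f : ℕ → ℕ satisfying x ^ (⌊log₂ x⌋) ≤ f x for all sufficiently large x (where ⌊log₂ x⌋ denotes the natural-number base-2 logarithm Nat.log 2 x), the conjugate c ∘ f ∘ c⁻¹ is not primitive recursive. -/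
theorem Primrec.nat_sum_range {e : ℕ → ℕ} (he : Primrec e) :
    Primrec fun n => ∑ i ∈ Finset.range n, e i := by
  refine (Primrec.nat_rec₁ (f := fun n c => c + e n) 0 ?_).of_eq fun n => ?_
  · exact Primrec.nat_add.comp .snd (he.comp .fst)
  · induction n with
    | zero => simp
    | succ n ih => rw [Finset.sum_range_succ, ← ih]

/-- The partial sums of an injective sequence of elements of `p` bound the enumeration of `p` in
increasing order. -/
theorem Nat.nth_le_sum_range_of_injective {p : ℕ → Prop} {e : ℕ → ℕ}
    (inj : Function.Injective e) (he : ∀ n, p (e n)) (n : ℕ) :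
    Nat.nth p n ≤ ∑ i ∈ Finset.range (n + 1), e i := by
  classical
  set M := ∑ i ∈ Finset.range (n + 1), e i
  refine Nat.le_of_lt_succ (Nat.nth_lt_of_lt_count ?_)
  rw [Nat.count_eq_card_filter_range, ← Nat.succ_le_iff]
  calc n + 1 = ((Finset.range (n + 1)).image e).card := by
        rw [Finset.card_image_of_injective _ inj, Finset.card_range]
    _ ≤ _ := by
        refine Finset.card_le_card fun m hm => ?_
        obtain ⟨i, hi, rfl⟩ := Finset.mem_image.1 hm
        simp only [Finset.mem_filter, Finset.mem_range]
        exact ⟨Nat.lt_succ_of_le (Finset.single_le_sum (fun _ _ => Nat.zero_le _) hi), he i⟩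

theorem Primrec.nat_nth_s3 {p : ℕ → Prop} (hp : PrimrecPred p) {e : ℕ → ℕ} (he : Primrec e)
    (inj : Function.Injective e) (hpe : ∀ n, p (e n)) : Primrec (Nat.nth p) := by
  classical
  have hinf : (Set.ofPred p).Infinite :=
    (Set.infinite_range_of_injective inj).mono (by rintro _ ⟨n, rfl⟩; exact hpe n)
  have key : ∀ n m, Nat.nth p n = m ↔ p m ∧ Nat.count p m = n := fun n m => by
    constructor
    · rintro rfl
      exact ⟨Nat.nth_mem_of_infinite hinf n, Nat.count_nth_of_infinite hinf n⟩
    · rintro ⟨h, rfl⟩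
      exact Nat.nth_count h
  refine Primrec.of_graph
    ⟨_, (Primrec.nat_sum_range he).comp Primrec.succ,
      Nat.nth_le_sum_range_of_injective inj hpe⟩ ?_
  exact PrimrecRel.of_eq (r := fun n m => p m ∧ Nat.count p m = n)
    (PrimrecPred.and (hp.comp Primrec.snd)
      (Primrec.eq.comp ((Primrec.nat_count hp).comp .snd) .fst)) fun n m => (key n m).symm

/-- An injective primitive recursive sequence with primitive recursive range is, up to a primitive
recursive recoding of its values, a permutation of `ℕ`. -/
theorem exists_equiv_of_primrecPred_range {α : Type*} [Primcodable α] {g : ℕ → α} (hg : Primrec g)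
    (inj : Function.Injective g) (hr : PrimrecPred fun a => ∃ n, g n = a) :
    ∃ (c : ℕ ≃ ℕ) (φ : ℕ → α) (ψ : α → ℕ), Primrec φ ∧ Primrec ψ ∧
      (∀ n, φ (c n) = g n) ∧ ∀ n, ψ (g n) = c n := by
  classical
  let e : ℕ → ℕ := fun n => Encodable.encode (g n)
  let p : ℕ → Prop := fun m => ∃ n, e n = m
  have he : Primrec e := Primrec.encode.comp hg
  have einj : Function.Injective e := Encodable.encode_injective.comp inj
  have hpe : ∀ n, p (e n) := fun n => ⟨n, rfl⟩
  have hp : PrimrecPred p := by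
    have : Primrec fun m : ℕ => ((Encodable.decode₂ α m).casesOn (motive := fun _ => Bool) false
        (fun a => decide (∃ n, g n = a)) : Bool) :=
      Primrec.option_casesOn Primrec.decode₂ (.const _) (hr.decide.comp .snd)
    refine (Primrec.primrecPred (p := p) (this.of_eq fun m => ?_))
    cases h : Encodable.decode₂ α m with
    | none =>
      symm
      simp only [decide_eq_false_iff_not]
      rintro ⟨n, rfl⟩
      simp [e] at h
    | some a =>
      rw [Encodable.decode₂_eq_some] at h
      subst h
      simp [p, e, Encodable.encode_inj]
  have hinf : (Set.ofPred p).Infinite :=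
    (Set.infinite_range_of_injective einj).mono (by rintro _ ⟨n, rfl⟩; exact hpe n)
  have bij : Function.Bijective fun n => Nat.count p (e n) := by
    refine ⟨fun m n h => einj (Nat.count_injective (hpe m) (hpe n) h), fun n => ?_⟩
    obtain ⟨k, hk⟩ : p (Nat.nth p n) := Nat.nth_mem_of_infinite hinf n
    exact ⟨k, by simp only [hk, Nat.count_nth_of_infinite hinf n]⟩
  refine ⟨Equiv.ofBijective _ bij, fun x => (Encodable.decode (Nat.nth p x)).getD (g 0),
    fun a => Nat.count p (Encodable.encode a), ?_, ?_, fun n => ?_, fun n => rfl⟩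
  · exact Primrec.option_getD.comp (Primrec.decode.comp (Primrec.nat_nth_s3 hp he einj hpe))
      (.const _)
  · exact (Primrec.nat_count hp).comp Primrec.encode
  · simp [Nat.nth_count (hpe n), e]

theorem Primrec.nat_pow : Primrec₂ ((· ^ ·) : ℕ → ℕ → ℕ) :=
  Primrec₂.unpaired'.1 Nat.Primrec.pow

theorem Primrec.nat_ofDigits : Primrec₂ fun (b : ℕ) (L : List ℕ) => Nat.ofDigits b L := by
  refine (Primrec.list_foldr (f := fun x : ℕ × List ℕ => x.2) (g := fun _ => 0)
    (h := fun x y => y.1 + x.1 * y.2) .snd (.const 0) ?_).of_eq fun x => ?_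
  · exact Primrec.nat_add.comp (Primrec.fst.comp .snd)
      (Primrec.nat_mul.comp (Primrec.fst.comp .fst) (Primrec.snd.comp .snd))
  · simp [Nat.ofDigits_eq_foldr]

theorem Primrec.nat_list_sum : Primrec (List.sum : List ℕ → ℕ) :=
  (Primrec.nat_ofDigits.comp (.const 1) .id).of_eq fun L => Nat.ofDigits_one L

theorem Nat.digits_eq_map_range {b n : ℕ} (hb : 1 < b) (hn : n ≠ 0) :
    Nat.digits b n = (List.range (Nat.log b n + 1)).map fun i => n / b ^ i % b := by
  refine List.ext_getElem (by simp [Nat.length_digits b n hb hn]) fun i h₁ h₂ => ?_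
  rw [← List.getD_eq_getElem (Nat.digits b n) 0 h₁, Nat.getD_digits n i hb]
  simp

theorem Primrec.nat_log : Primrec₂ Nat.log := by
  refine (Primrec.ite (c := fun x : ℕ × ℕ => 1 < x.1 ∧ x.2 ≠ 0)
    (PrimrecPred.and (Primrec.nat_lt.comp (.const 1) .fst)
      (Primrec.eq.comp .snd (.const 0)).not)
    (Primrec.nat_findGreatest (f := Prod.snd) (p := fun x k => x.1 ^ k ≤ x.2) .snd
      (Primrec.nat_le.comp (Primrec.nat_pow.comp (Primrec.fst.comp .fst) .snd)
        (Primrec.snd.comp .fst))) (.const 0)).of_eq fun x => ?_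
  obtain ⟨b, n⟩ := x
  split_ifs with h
  · rw [Nat.findGreatest_eq_iff]
    refine ⟨Nat.log_le_self b n, fun _ => Nat.pow_log_le_self b h.2, fun k hk _ => ?_⟩
    exact not_le.2 (Nat.lt_pow_of_log_lt h.1 hk)
  · symm
    rw [Nat.log_eq_zero_iff]
    simp only at h
    by_cases hb : 1 < b
    · left
      have : n = 0 := by simpa [hb] using h
      omega
    · right; omega

/-- Computes `Nat.digits` correctly in every base at least two. -/
theorem Primrec.nat_digits : Primrec₂ fun b n : ℕ => Nat.digits (b + 2) n := by
  refine (Primrec.ite (c := fun x : ℕ × ℕ => x.2 = 0) (Primrec.eq.comp .snd (.const 0))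
    (.const [])
    (Primrec.list_map (f := fun x : ℕ × ℕ => List.range (Nat.log (x.1 + 2) x.2 + 1))
      (g := fun x i => x.2 / (x.1 + 2) ^ i % (x.1 + 2)) ?_ ?_)).of_eq fun x => ?_
  · exact Primrec.list_range.comp (Primrec.succ.comp (Primrec.nat_log.comp
      (Primrec.nat_add.comp .fst (.const 2)) .snd))
  · have : Primrec fun x : (ℕ × ℕ) × ℕ => x.1.1 + 2 :=
      Primrec.nat_add.comp (Primrec.fst.comp .fst) (.const 2)
    exact Primrec.nat_mod.comp (Primrec.nat_div.comp (Primrec.snd.comp .fst)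
      (Primrec.nat_pow.comp this .snd)) this
  · split_ifs with h
    · simp [h]
    · exact (Nat.digits_eq_map_range (by omega) h).symm

/-- The values `min (ack m n) k` for `n ≤ k`. -/
def ackRow (k : ℕ) : ℕ → List ℕ
  | 0 => (List.range (k + 1)).map fun n => min (n + 1) k
  | m + 1 => (List.range (k + 1)).map fun n =>
      n.rec ((ackRow k m).getD 1 k) fun _ v => (ackRow k m).getD v k

theorem ackRow_getD (k m n : ℕ) : (ackRow k m).getD n k = min (ack m n) k := by
  have large : ∀ m n, k < n → min (ack m n) k = k := fun m n h =>
    min_eq_right (h.le.trans (lt_ack_right m n).le)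
  have getD : ∀ (f : ℕ → ℕ) (m n : ℕ), (∀ n, f n = min (ack m n) k) →
      ((List.range (k + 1)).map f).getD n k = min (ack m n) k := fun f m n hf => by
    rcases Nat.lt_or_ge k n with h | h
    · rw [List.getD_eq_default _ _ (by simp; omega), large m n h]
    · rw [List.getD_eq_getElem _ _ (by simp; omega)]
      simp [hf]
  induction m generalizing n with
  | zero => exact getD _ 0 n fun n => by simp
  | succ m ih =>
    refine getD _ (m + 1) n fun n => ?_
    induction n with
    | zero => rw [ack_succ_zero, ← ih]; rfl
    | succ n ih' =>
      simp only [ih, ack_succ_succ] at ih' ⊢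
      rw [ih']
      rcases le_total (ack (m + 1) n) k with h | h
      · rw [min_eq_left h]
      · rw [min_eq_right h, min_eq_right (lt_ack_right m k).le,
          min_eq_right (h.trans (lt_ack_right m _).le)]

theorem primrec_ackRow : Primrec₂ ackRow := by
  refine (Primrec.nat_rec (f := fun k : ℕ => (List.range (k + 1)).map fun n => min (n + 1) k)
    (g := fun (k : ℕ) (x : ℕ × List ℕ) => (List.range (k + 1)).map fun n =>
      n.rec (x.2.getD 1 k) fun _ v => x.2.getD v k) ?_ ?_).of_eq fun k m => ?_
  · exact Primrec.list_map (Primrec.list_range.comp .succ)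
      (Primrec.nat_min.comp (Primrec.succ.comp .snd) .fst)
  · have getD : Primrec₂ fun (x : ℕ × List ℕ) v => x.2.getD v x.1 :=
      (Primrec.option_getD.comp (Primrec.list_getElem?.comp (Primrec.snd.comp .fst) .snd)
        (Primrec.fst.comp .fst)).of_eq fun x => by simp [List.getD]
    refine Primrec.list_map (Primrec.list_range.comp (Primrec.succ.comp .fst)) ?_
    refine Primrec.nat_rec' (f := fun x : (ℕ × ℕ × List ℕ) × ℕ => x.2)
      (g := fun x => x.1.2.2.getD 1 x.1.1) (h := fun x y => x.1.2.2.getD y.2 x.1.1) .snd ?_ ?_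
    · exact getD.comp (Primrec.pair (Primrec.fst.comp .fst) (Primrec.snd.comp
        (Primrec.snd.comp .fst))) (.const 1)
    · have h₁ : Primrec fun x : ((ℕ × ℕ × List ℕ) × ℕ) × ℕ × ℕ => x.1.1 :=
        Primrec.fst.comp .fst
      exact getD.comp (Primrec.pair (Primrec.fst.comp h₁) (Primrec.snd.comp
        (Primrec.snd.comp h₁))) (Primrec.snd.comp .snd)
  · induction m with
    | zero => rfl
    | succ m ih => simp only [ackRow, ← ih]

theorem primrec_min_ack : Primrec fun x : ℕ × ℕ × ℕ => min (ack x.1 x.2.1) x.2.2 := by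
  have hk : Primrec fun x : ℕ × ℕ × ℕ => x.2.2 := Primrec.snd.comp .snd
  refine (Primrec.option_getD.comp (Primrec.list_getElem?.comp
    (primrec_ackRow.comp hk .fst) (Primrec.fst.comp .snd)) hk).of_eq fun x => ?_
  rw [← ackRow_getD]
  rfl

theorem Nat.ofDigits_map_range (b : ℕ) (f : ℕ → ℕ) (n : ℕ) :
    Nat.ofDigits b ((List.range n).map f) = ∑ i ∈ Finset.range n, f i * b ^ i := by
  induction n with
  | zero => simp
  | succ n ih =>
    rw [List.range_succ, List.map_append, Nat.ofDigits_append, ih, Finset.sum_range_succ]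
    simp [mul_comm]

open Polynomial in
/-- The coefficients of a polynomial, read as digits of its values at large arguments. -/
theorem Polynomial.exists_eval_eq_ofDigits (P : ℕ[X]) :
    ∃ L : List ℕ, L.length ≤ P.natDegree + 1 ∧ L.sum = P.eval 1 ∧
      (∀ b, P.eval b = Nat.ofDigits b L) ∧
      ∀ b, 1 < b → P.eval 1 < b → Nat.digits b (P.eval b) = L := by
  suffices h : ∃ L : List ℕ, L.length ≤ P.natDegree + 1 ∧ (∀ h : L ≠ [], L.getLast h ≠ 0) ∧
      ∀ b, P.eval b = Nat.ofDigits b L by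
    obtain ⟨L, hlen, hlast, hL⟩ := h
    have hsum : L.sum = P.eval 1 := by rw [hL, Nat.ofDigits_one]
    refine ⟨L, hlen, hsum, hL, fun b hb h => ?_⟩
    rw [hL b, Nat.digits_ofDigits b hb L (fun l hl => ?_) hlast]
    exact (List.single_le_sum (by simp) l hl).trans_lt (hsum ▸ h)
  by_cases h0 : P = 0
  · exact ⟨[], by simp, by simp, by simp [h0]⟩
  · refine ⟨(List.range (P.natDegree + 1)).map P.coeff, by simp, fun _ => ?_, fun b => ?_⟩
    · simp [List.getLast_map, h0]
    · rw [Nat.ofDigits_map_range, eval_eq_sum_range]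

theorem Nat.add_mul_le_add_mul_iff {B c d x y : ℕ} (hc : c < B) (hd : d < B) :
    c + B * x ≤ d + B * y ↔ x < y ∨ x ≤ y ∧ y ≤ x ∧ c ≤ d := by
  rcases lt_trichotomy x y with h | rfl | h
  · have := Nat.mul_le_mul_left B (Nat.succ_le_of_lt h)
    rw [Nat.mul_succ] at this
    simp only [h, true_or, iff_true]; omega
  · simp
  · have := Nat.mul_le_mul_left B (Nat.succ_le_of_lt h)
    rw [Nat.mul_succ] at this
    simp only [h.not_gt, h.not_ge, false_and, or_self, iff_false]; omega

theorem Nat.ofDigits_eq_headI_add (b : ℕ) (L : List ℕ) :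
    Nat.ofDigits b L = L.headI + b * Nat.ofDigits b L.tail := by
  cases L <;> simp [Nat.ofDigits_cons]

/-- The order of two digit sequences does not depend on the base. -/
theorem Nat.ofDigits_le_ofDigits_iff {B b : ℕ} (hB : 0 < B) (hb : 0 < b) {L M : List ℕ}
    (hL : ∀ d ∈ L, d < B ∧ d < b) (hM : ∀ d ∈ M, d < B ∧ d < b) :
    Nat.ofDigits B L ≤ Nat.ofDigits B M ↔ Nat.ofDigits b L ≤ Nat.ofDigits b M := by
  have head : ∀ {L : List ℕ}, (∀ d ∈ L, d < B ∧ d < b) → L.headI < B ∧ L.headI < b := by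
    rintro (_ | ⟨c, L⟩) h
    · exact ⟨hB, hb⟩
    · exact h c (by simp)
  have tail : ∀ {L : List ℕ}, (∀ d ∈ L, d < B ∧ d < b) → ∀ d ∈ L.tail, d < B ∧ d < b :=
    fun h d hd => h d (List.mem_of_mem_tail hd)
  induction hn : L.length + M.length using Nat.strong_induction_on generalizing L M with
  | _ n ih =>
    rcases Nat.eq_zero_or_pos n with rfl | hpos
    · have : L = [] ∧ M = [] := by simpa using hn
      simp [this.1, this.2]
    · have hlt : L.tail.length + M.tail.length < n := by simp; omega
      have h₁ : Nat.ofDigits B L.tail ≤ Nat.ofDigits B M.tail ↔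
          Nat.ofDigits b L.tail ≤ Nat.ofDigits b M.tail := ih _ hlt (tail hL) (tail hM) rfl
      have h₂ : Nat.ofDigits B M.tail ≤ Nat.ofDigits B L.tail ↔
          Nat.ofDigits b M.tail ≤ Nat.ofDigits b L.tail :=
        ih _ hlt (tail hM) (tail hL) (add_comm _ _)
      rw [Nat.ofDigits_eq_headI_add B L, Nat.ofDigits_eq_headI_add B M,
        Nat.ofDigits_eq_headI_add b L, Nat.ofDigits_eq_headI_add b M,
        Nat.add_mul_le_add_mul_iff (head hL).1 (head hM).1,
        Nat.add_mul_le_add_mul_iff (head hL).2 (head hM).2,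
        lt_iff_le_not_ge, lt_iff_le_not_ge, h₁, h₂]

/-- A diagonal branch of the Ackermann function: the exponents of the bases in which the copy
writes numbers. -/
def level (p : ℕ) : ℕ := ack (p + 4) (p + 4)

theorem ack_level_le (p : ℕ) : ack (p + 4) (level p) ≤ level (p + 1) := by
  change ack (p + 4) (ack (p + 4) (p + 4)) ≤ ack (p + 4 + 1) (p + 4 + 1)
  rw [ack_succ_succ (p + 4) (p + 4)]
  exact ack_mono_right _ (ack_mono_left _ (Nat.le_succ _))

theorem lt_level (p : ℕ) : p + 4 < level p := lt_ack_left _ _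

theorem level_mul_self_le (p : ℕ) : level p * level p ≤ level (p + 1) := by
  have h := ack_add_one_sq_lt_ack_add_four p (level p)
  have h' := lt_ack_right p ((level p + 1) ^ 2)
  have := ack_level_le p
  nlinarith

theorem level_strictMono : StrictMono level :=
  strictMono_nat_of_lt_succ fun p => (lt_ack_right _ _).trans_le (ack_level_le p)

theorem primrec_min_level : Primrec₂ fun p k => min (level p) k := by
  have h : Primrec fun x : ℕ × ℕ => x.1 + 4 := Primrec.nat_add.comp .fst (.const 4)
  exact primrec_min_ack.comp (h.pair (h.pair .snd))

theorem two_pow_min_level_le_iff (p n : ℕ) : 2 ^ min (level p) n ≤ n ↔ 2 ^ level p ≤ n := by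
  rcases le_total (level p) n with h | h
  · rw [min_eq_left h]
  · rw [min_eq_right h]
    have h₁ := Nat.lt_two_pow_self (n := n)
    have h₂ := Nat.pow_le_pow_right (n := 2) (by norm_num) h
    omega

/-- The index of the base in which `n` is written. -/
def phase (n : ℕ) : ℕ := Nat.findGreatest (fun p => 2 ^ level p ≤ n) n

theorem two_pow_level_phase_le {n : ℕ} (h : 0 < phase n) : 2 ^ level (phase n) ≤ n :=
  Nat.findGreatest_of_ne_zero (P := fun p => 2 ^ level p ≤ n) rfl h.ne'

theorem phase_eq {p n : ℕ} (h₁ : 2 ^ level p ≤ n) (h₂ : n < 2 ^ level (p + 1)) :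
    phase n = p := by
  rw [phase, Nat.findGreatest_eq_iff]
  refine ⟨?_, fun _ => h₁, fun k hk _ h => ?_⟩
  · have := lt_level p
    have := Nat.lt_two_pow_self (n := level p)
    omega
  · have := Nat.pow_le_pow_right (n := 2) (by norm_num) (level_strictMono.monotone (Nat.succ_le_of_lt hk))
    simp only [Nat.succ_eq_add_one] at this
    omega

theorem primrec_phase : Primrec phase := by
  refine (Primrec.nat_findGreatest (f := fun n : ℕ => n)
    (p := fun n p => 2 ^ min (level p) n ≤ n) .id ?_).of_eq fun n => ?_
  · exact Primrec.nat_le.comp (Primrec.nat_pow.comp (.const 2)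
      (primrec_min_level.comp .snd .fst)) .fst
  · simp only [two_pow_min_level_le_iff]
    rfl

/-- The code of a number `n`: the list of its digits in base `2 ^ level (phase n)` if these are
few and small, and `n` itself otherwise. The first component names the base, and the second one
witnesses that all smaller bases are known. -/
def code (n : ℕ) : (ℕ × ℕ) × List ℕ :=
  if 0 < phase n ∧ (Nat.digits (2 ^ level (phase n)) n).sum +
      (Nat.digits (2 ^ level (phase n)) n).length ≤ level (phase n) then
    ((phase n, level (phase n - 1)), Nat.digits (2 ^ level (phase n)) n)
  else ((0, 0), [n])

/-- The number denoted by a code. -/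
def codeVal (x : (ℕ × ℕ) × List ℕ) : ℕ := Nat.ofDigits (2 ^ level x.1.1) x.2

theorem codeVal_code (n : ℕ) : codeVal (code n) = n := by
  unfold code
  split_ifs <;> simp [codeVal, Nat.ofDigits_digits]

theorem code_injective : Function.Injective code :=
  Function.LeftInverse.injective codeVal_code

theorem code_of_fst_eq_zero {n : ℕ} (h : (code n).1.1 = 0) : code n = ((0, 0), [n]) := by
  unfold code at h ⊢
  split_ifs at h ⊢ with h'
  · simp only at h; omega
  · rfl

theorem code_witness {n : ℕ} (h : 0 < (code n).1.1) :
    (code n).1.2 = level ((code n).1.1 - 1) := by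
  unfold code at h ⊢
  split_ifs at h ⊢ with h'
  · rfl
  · simp at h

theorem primrec_code : Primrec code := by
  have hlev : Primrec fun n => min (level (phase n)) n := primrec_min_level.comp primrec_phase .id
  have hdig : Primrec fun n => Nat.digits (2 ^ min (level (phase n)) n - 2 + 2) n :=
    Primrec.nat_digits.comp (Primrec.nat_sub.comp (Primrec.nat_pow.comp (.const 2) hlev)
      (.const 2)) .id
  refine (Primrec.ite (c := fun n => 0 < phase n ∧
      (Nat.digits (2 ^ min (level (phase n)) n - 2 + 2) n).sum +
      (Nat.digits (2 ^ min (level (phase n)) n - 2 + 2) n).length ≤ min (level (phase n)) n)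
    (PrimrecPred.and (Primrec.nat_lt.comp (.const 0) primrec_phase)
      (Primrec.nat_le.comp (Primrec.nat_add.comp (Primrec.nat_list_sum.comp hdig)
        (Primrec.list_length.comp hdig)) hlev))
    (Primrec.pair (Primrec.pair primrec_phase (primrec_min_level.comp
      (Primrec.pred.comp primrec_phase) .id)) hdig)
    (Primrec.pair (.const (0, 0)) (Primrec.list_cons.comp .id (.const [])))).of_eq fun n => ?_
  by_cases h : 0 < phase n
  · have h₁ := two_pow_level_phase_le h
    have h₂ := Nat.lt_two_pow_self (n := level (phase n))
    have h₃ := lt_level (phase n)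
    have h₄ : level (phase n - 1) ≤ level (phase n) := level_strictMono.monotone (by omega)
    have h₅ : 2 ^ level (phase n) - 2 + 2 = 2 ^ level (phase n) := by omega
    simp only [code, Nat.pred_eq_sub_one, min_eq_left (h₂.le.trans h₁),
      min_eq_left (h₄.trans (h₂.le.trans h₁)), h₅, id]
  · simp [code, h]

/-- The code of `N` computed as if its base, with index `p`, were `B + 2`. -/
def provisionalCode (p s B N : ℕ) : (ℕ × ℕ) × List ℕ :=
  if 0 < p ∧ B + 2 ≤ N then ((p, s), Nat.digits (B + 2) N) else code N

open Polynomial in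
theorem provisionalCode_eval_eq {p s B : ℕ} {P : ℕ[X]} (hP : P.eval 1 + P.natDegree ≤ B)
    (hB : B + 2 ≤ level p) (hs : 0 < p → s = level (p - 1)) (h0 : p = 0 → P.natDegree = 0) :
    provisionalCode p s B (P.eval (B + 2)) = code (P.eval (2 ^ level p)) := by
  obtain ⟨L, hlen, hsum, hval, hdig⟩ := P.exists_eval_eq_ofDigits
  have hb := Nat.lt_two_pow_self (n := level p)
  have hd₁ := hdig (B + 2) (by omega) (by omega)
  have hd₂ := hdig (2 ^ level p) (by omega) (by omega)
  have e₁ := Nat.lt_digits_length_iff (b := B + 2) (k := 1) (by omega) (P.eval (B + 2))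
  have e₂ := Nat.lt_digits_length_iff (b := 2 ^ level p) (k := 1) (by omega)
    (P.eval (2 ^ level p))
  rw [hd₁, pow_one] at e₁
  rw [hd₂, pow_one] at e₂
  unfold provisionalCode
  split_ifs with h
  · have hlt := Nat.lt_base_pow_length_digits (b := 2 ^ level p) (m := P.eval (2 ^ level p))
      (by omega)
    rw [hd₂] at hlt
    have hphase : phase (P.eval (2 ^ level p)) = p := by
      refine phase_eq (e₂.1 (e₁.2 h.2)) (hlt.trans_le ?_)
      rw [← pow_mul]
      refine Nat.pow_le_pow_right (by norm_num) (le_trans ?_ (level_mul_self_le p))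
      exact Nat.mul_le_mul_left _ (by omega)
    rw [code, hphase, hd₂, if_pos ⟨h.1, by omega⟩, hd₁, hs h.1]
  · have : L.length ≤ 1 := by
      rcases Nat.eq_zero_or_pos p with hp | hp
      · exact hlen.trans (by rw [h0 hp])
      · rw [← not_lt, e₁]; exact fun h' => h ⟨hp, h'⟩
    congr 1
    rw [hval, hval]
    match L, this with
    | [], _ => rfl
    | [c], _ => simp

open Polynomial in
theorem eval_ofDigits_X (b : ℕ) (L : List ℕ) :
    (Nat.ofDigits (X : ℕ[X]) L).eval b = Nat.ofDigits b L := by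
  induction L with
  | nil => simp [Nat.ofDigits]
  | cons c L ih => simp [Nat.ofDigits, ih]

open Polynomial in
theorem natDegree_ofDigits_X_le (L : List ℕ) :
    (Nat.ofDigits (X : ℕ[X]) L).natDegree ≤ L.length - 1 := by
  induction L with
  | nil => simp [Nat.ofDigits]
  | cons c L ih =>
    have e : Nat.ofDigits (X : ℕ[X]) (c :: L) = (c : ℕ[X]) + X * Nat.ofDigits (X : ℕ[X]) L := rfl
    rw [e]
    rcases L with _ | ⟨d, L⟩
    · simp [Nat.ofDigits]
    · refine (natDegree_add_le _ _).trans (max_le (by simp) (natDegree_mul_le.trans ?_))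
      have := natDegree_X_le (R := ℕ)
      simp at ih ⊢
      omega

/-- The number denoted by a code, provided the exponent of its base is at most `k`. -/
def truncVal (x : (ℕ × ℕ) × List ℕ) (k : ℕ) : ℕ := Nat.ofDigits (2 ^ min (level x.1.1) k) x.2

theorem truncVal_code {n k : ℕ} (h : level (code n).1.1 ≤ k) : truncVal (code n) k = n := by
  rw [truncVal, min_eq_left h]
  exact codeVal_code n

theorem primrec_truncVal : Primrec₂ truncVal :=
  Primrec.nat_ofDigits.comp (Primrec.nat_pow.comp (.const 2)
    (primrec_min_level.comp (Primrec.fst.comp (Primrec.fst.comp .fst)) .snd))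
    (Primrec.snd.comp .fst)

theorem primrec_provisionalCode :
    Primrec fun x : ((ℕ × ℕ) × ℕ) × ℕ => provisionalCode x.1.1.1 x.1.1.2 x.1.2 x.2 := by
  have hps : Primrec fun x : ((ℕ × ℕ) × ℕ) × ℕ => x.1.1 := Primrec.fst.comp .fst
  have hB : Primrec fun x : ((ℕ × ℕ) × ℕ) × ℕ => x.1.2 := Primrec.snd.comp .fst
  exact Primrec.ite
    (PrimrecPred.and (Primrec.nat_lt.comp (.const 0) (Primrec.fst.comp hps))
      (Primrec.nat_le.comp (Primrec.nat_add.comp hB (.const 2)) .snd))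
    (Primrec.pair hps (Primrec.nat_digits.comp hB .snd)) (primrec_code.comp .snd)

/-- The digits of `x` in the base with index `p`, where `s` bounds the exponents of all smaller
bases. -/
def digitsAt (p s : ℕ) (x : (ℕ × ℕ) × List ℕ) : List ℕ :=
  if x.1.1 = p then x.2 else [truncVal x s]

theorem primrec_digitsAt :
    Primrec fun x : (ℕ × ℕ) × ((ℕ × ℕ) × List ℕ) => digitsAt x.1.1 x.1.2 x.2 :=
  Primrec.ite (Primrec.eq.comp (Primrec.fst.comp (Primrec.fst.comp .snd))
      (Primrec.fst.comp .fst))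
    (Primrec.snd.comp .snd)
    (Primrec.list_cons.comp (primrec_truncVal.comp .snd (Primrec.snd.comp .fst)) (.const []))

theorem ofDigits_digitsAt_code {p s n : ℕ} (hp : (code n).1.1 ≤ p)
    (hs : 0 < p → s = level (p - 1)) :
    Nat.ofDigits (2 ^ level p) (digitsAt p s (code n)) = n := by
  unfold digitsAt
  split_ifs with h
  · subst h
    exact codeVal_code n
  · rw [Nat.ofDigits_singleton, truncVal_code]
    rw [hs (by omega)]
    exact level_strictMono.monotone (by omega)

theorem length_digitsAt_zero_code {s n : ℕ} : (digitsAt 0 s (code n)).length = 1 := by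
  unfold digitsAt
  split_ifs with h
  · rw [code_of_fst_eq_zero h]; rfl
  · rfl

/-- The larger of the base indices of two codes. -/
def jointIndex (z : ((ℕ × ℕ) × List ℕ) × ((ℕ × ℕ) × List ℕ)) : ℕ := max z.1.1.1 z.2.1.1

/-- The larger of the witnesses of two codes. -/
def jointWitness (z : ((ℕ × ℕ) × List ℕ) × ((ℕ × ℕ) × List ℕ)) : ℕ := max z.1.1.2 z.2.1.2

/-- The digits of the first code in the larger of the two bases. -/
def leftDigits (z : ((ℕ × ℕ) × List ℕ) × ((ℕ × ℕ) × List ℕ)) : List ℕ :=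
  digitsAt (jointIndex z) (jointWitness z) z.1

/-- The digits of the second code in the larger of the two bases. -/
def rightDigits (z : ((ℕ × ℕ) × List ℕ) × ((ℕ × ℕ) × List ℕ)) : List ℕ :=
  digitsAt (jointIndex z) (jointWitness z) z.2

theorem primrec_jointIndex : Primrec jointIndex :=
  Primrec.nat_max.comp (Primrec.fst.comp (Primrec.fst.comp .fst))
    (Primrec.fst.comp (Primrec.fst.comp .snd))

theorem primrec_jointWitness : Primrec jointWitness :=
  Primrec.nat_max.comp (Primrec.snd.comp (Primrec.fst.comp .fst))
    (Primrec.snd.comp (Primrec.fst.comp .snd))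

theorem primrec_leftDigits : Primrec leftDigits :=
  primrec_digitsAt.comp ((primrec_jointIndex.pair primrec_jointWitness).pair .fst)

theorem primrec_rightDigits : Primrec rightDigits :=
  primrec_digitsAt.comp ((primrec_jointIndex.pair primrec_jointWitness).pair .snd)

theorem code_witness_eq_zero {n : ℕ} (h : (code n).1.1 = 0) : (code n).1.2 = 0 := by
  rw [code_of_fst_eq_zero h]

theorem code_witness_le {n p : ℕ} (h : (code n).1.1 ≤ p) : (code n).1.2 ≤ level (p - 1) := by
  rcases Nat.eq_zero_or_pos (code n).1.1 with h0 | h0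
  · rw [code_witness_eq_zero h0]; exact Nat.zero_le _
  · rw [code_witness h0]
    exact level_strictMono.monotone (by omega)

theorem jointWitness_code {n m : ℕ} (h : 0 < jointIndex (code n, code m)) :
    jointWitness (code n, code m) = level (jointIndex (code n, code m) - 1) := by
  have h₁ : (code n).1.2 ≤ level (jointIndex (code n, code m) - 1) :=
    code_witness_le (le_max_left _ _)
  have h₂ : (code m).1.2 ≤ level (jointIndex (code n, code m) - 1) :=
    code_witness_le (le_max_right _ _)
  refine le_antisymm (max_le h₁ h₂) ?_
  rcases max_choice (code n).1.1 (code m).1.1 with e | e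
  · have e : jointIndex (code n, code m) = (code n).1.1 := e
    rw [e, ← code_witness (e ▸ h)]
    exact le_max_left _ _
  · have e : jointIndex (code n, code m) = (code m).1.1 := e
    rw [e, ← code_witness (e ▸ h)]
    exact le_max_right _ _

theorem ofDigits_leftDigits (n m : ℕ) :
    Nat.ofDigits (2 ^ level (jointIndex (code n, code m))) (leftDigits (code n, code m)) = n :=
  ofDigits_digitsAt_code (le_max_left _ _) jointWitness_code

theorem ofDigits_rightDigits (n m : ℕ) :
    Nat.ofDigits (2 ^ level (jointIndex (code n, code m))) (rightDigits (code n, code m)) = m :=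
  ofDigits_digitsAt_code (le_max_right _ _) jointWitness_code

open Polynomial in
/-- An operation on numbers that is induced by one on polynomials is primitive recursive on
codes. -/
theorem exists_primrec_code_op {op : ℕ → ℕ → ℕ} (hop : Primrec₂ op)
    (opPoly : ℕ[X] → ℕ[X] → ℕ[X])
    (heval : ∀ P Q b, (opPoly P Q).eval b = op (P.eval b) (Q.eval b))
    (hdeg : ∀ P Q, (opPoly P Q).natDegree ≤ P.natDegree + Q.natDegree) :
    ∃ F : ((ℕ × ℕ) × List ℕ) × ((ℕ × ℕ) × List ℕ) → (ℕ × ℕ) × List ℕ, Primrec F ∧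
      ∀ n m, F (code n, code m) = code (op n m) := by
  let bound : ((ℕ × ℕ) × List ℕ) × ((ℕ × ℕ) × List ℕ) → ℕ := fun z =>
    op (leftDigits z).sum (rightDigits z).sum + ((leftDigits z).length + (rightDigits z).length)
  have hbound : Primrec bound := Primrec.nat_add.comp
    (hop.comp (Primrec.nat_list_sum.comp primrec_leftDigits)
      (Primrec.nat_list_sum.comp primrec_rightDigits))
    (Primrec.nat_add.comp (Primrec.list_length.comp primrec_leftDigits)
      (Primrec.list_length.comp primrec_rightDigits))
  have hbound₂ : Primrec fun z => bound z + 2 := Primrec.nat_add.comp hbound (.const 2)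
  refine ⟨fun z => if bound z + 2 ≤ min (level (jointIndex z)) (bound z + 2) then
      provisionalCode (jointIndex z) (jointWitness z) (bound z)
        (op (Nat.ofDigits (bound z + 2) (leftDigits z))
          (Nat.ofDigits (bound z + 2) (rightDigits z)))
    else code (op (truncVal z.1 (bound z + 2)) (truncVal z.2 (bound z + 2))), ?_, fun n m => ?_⟩
  · exact Primrec.ite
      (Primrec.nat_le.comp hbound₂ (primrec_min_level.comp primrec_jointIndex hbound₂))
      (primrec_provisionalCode.comp (Primrec.pair
        ((primrec_jointIndex.pair primrec_jointWitness).pair hbound)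
        (hop.comp (Primrec.nat_ofDigits.comp hbound₂ primrec_leftDigits)
          (Primrec.nat_ofDigits.comp hbound₂ primrec_rightDigits))))
      (primrec_code.comp (hop.comp (primrec_truncVal.comp .fst hbound₂)
        (primrec_truncVal.comp .snd hbound₂)))
  · dsimp only
    have hP := natDegree_ofDigits_X_le (leftDigits (code n, code m))
    have hQ := natDegree_ofDigits_X_le (rightDigits (code n, code m))
    have hPQ := hdeg (Nat.ofDigits X (leftDigits (code n, code m)))
      (Nat.ofDigits X (rightDigits (code n, code m)))
    split_ifs with h
    · have key := provisionalCode_eval_eq (p := jointIndex (code n, code m))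
        (s := jointWitness (code n, code m)) (B := bound (code n, code m))
        (P := opPoly (Nat.ofDigits X (leftDigits (code n, code m)))
          (Nat.ofDigits X (rightDigits (code n, code m)))) ?_ (le_min_iff.1 h).1
        jointWitness_code fun h0 => ?_
      · rwa [heval, heval, eval_ofDigits_X, eval_ofDigits_X, eval_ofDigits_X, eval_ofDigits_X,
          ofDigits_leftDigits, ofDigits_rightDigits] at key
      · rw [heval, eval_ofDigits_X, eval_ofDigits_X, Nat.ofDigits_one, Nat.ofDigits_one]
        simp only [bound]
        omega
      · have h₁ : (leftDigits (code n, code m)).length = 1 := by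
          rw [leftDigits, h0, length_digitsAt_zero_code]
        have h₂ : (rightDigits (code n, code m)).length = 1 := by
          rw [rightDigits, h0, length_digitsAt_zero_code]
        omega
    · have h' : level (jointIndex (code n, code m)) ≤ bound (code n, code m) + 2 := by
        simp only [le_min_iff, le_refl, and_true] at h
        omega
      rw [truncVal_code ((level_strictMono.monotone (le_max_left _ _)).trans h'),
        truncVal_code ((level_strictMono.monotone (le_max_right _ _)).trans h')]

theorem exists_primrecRel_code_le :
    ∃ R : (ℕ × ℕ) × List ℕ → (ℕ × ℕ) × List ℕ → Prop, PrimrecRel R ∧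
      ∀ n m, R (code n) (code m) ↔ n ≤ m := by
  let bound : ((ℕ × ℕ) × List ℕ) × ((ℕ × ℕ) × List ℕ) → ℕ := fun z =>
    (leftDigits z).sum + (rightDigits z).sum + 1
  have hbound : Primrec bound := Primrec.succ.comp (Primrec.nat_add.comp
    (Primrec.nat_list_sum.comp primrec_leftDigits)
    (Primrec.nat_list_sum.comp primrec_rightDigits))
  let R : ((ℕ × ℕ) × List ℕ) × ((ℕ × ℕ) × List ℕ) → Prop := fun z =>
    (bound z ≤ min (level (jointIndex z)) (bound z) ∧
      Nat.ofDigits (bound z) (leftDigits z) ≤ Nat.ofDigits (bound z) (rightDigits z)) ∨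
    (¬ bound z ≤ min (level (jointIndex z)) (bound z) ∧
      truncVal z.1 (bound z) ≤ truncVal z.2 (bound z))
  have hcond : PrimrecPred fun z => bound z ≤ min (level (jointIndex z)) (bound z) :=
    Primrec.nat_le.comp hbound (primrec_min_level.comp primrec_jointIndex hbound)
  have hR : PrimrecPred R :=
    (hcond.and (Primrec.nat_le.comp (Primrec.nat_ofDigits.comp hbound primrec_leftDigits)
      (Primrec.nat_ofDigits.comp hbound primrec_rightDigits))).or
    (hcond.not.and (Primrec.nat_le.comp (primrec_truncVal.comp .fst hbound)
      (primrec_truncVal.comp .snd hbound)))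
  refine ⟨fun x y => R (x, y), hR, fun n m => ?_⟩
  simp only [R]
  by_cases h : bound (code n, code m) ≤
      min (level (jointIndex (code n, code m))) (bound (code n, code m))
  · simp only [h, true_and, not_true, false_and, or_false]
    have h' := (le_min_iff.1 h).1
    have hlt := Nat.lt_two_pow_self (n := level (jointIndex (code n, code m)))
    rw [Nat.ofDigits_le_ofDigits_iff (b := 2 ^ level (jointIndex (code n, code m)))
      (Nat.succ_pos _) (by positivity) (fun d hd => ?_) (fun d hd => ?_), ofDigits_leftDigits,
      ofDigits_rightDigits]
    all_goals
      have := List.single_le_sum (by simp) d hd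
      simp only [bound] at h' ⊢
      omega
  · have h' : level (jointIndex (code n, code m)) ≤ bound (code n, code m) := by
      simp only [le_min_iff, le_refl, and_true] at h
      omega
    simp only [h, false_and, not_false_iff, true_and, false_or]
    rw [truncVal_code ((level_strictMono.monotone (le_max_left _ _)).trans h'),
      truncVal_code ((level_strictMono.monotone (le_max_right _ _)).trans h')]

open Polynomial in
theorem primrecPred_range_code : PrimrecPred fun x => ∃ n, code n = x := by
  let bound : (ℕ × ℕ) × List ℕ → ℕ := fun x => x.2.sum + x.2.length
  have hbound : Primrec bound := Primrec.nat_add.comp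
    (Primrec.nat_list_sum.comp .snd) (Primrec.list_length.comp .snd)
  have hbound₂ : Primrec fun x => bound x + 2 := Primrec.nat_add.comp hbound (.const 2)
  have hp : Primrec fun x : (ℕ × ℕ) × List ℕ => x.1.1 := Primrec.fst.comp .fst
  have hs : Primrec fun x : (ℕ × ℕ) × List ℕ => x.1.2 := Primrec.snd.comp .fst
  have hcond : PrimrecPred fun x : (ℕ × ℕ) × List ℕ =>
      bound x + 2 ≤ min (level x.1.1) (bound x + 2) :=
    Primrec.nat_le.comp hbound₂ (primrec_min_level.comp hp hbound₂)
  have main : PrimrecPred fun x : (ℕ × ℕ) × List ℕ =>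
      (x.1.1 = 0 ∧ code x.2.headI = x) ∨
      (0 < x.1.1 ∧ ((bound x + 2 ≤ min (level x.1.1) (bound x + 2) ∧
          (min (level (x.1.1 - 1)) (x.1.2 + 1) = x.1.2 ∧
            provisionalCode x.1.1 x.1.2 (bound x) (Nat.ofDigits (bound x + 2) x.2) = x)) ∨
        (¬ bound x + 2 ≤ min (level x.1.1) (bound x + 2) ∧
          code (truncVal x (bound x + 2)) = x))) :=
    ((Primrec.eq.comp hp (.const 0)).and
      (Primrec.eq.comp (primrec_code.comp (Primrec.list_headI.comp .snd)) .id)).or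
    ((Primrec.nat_lt.comp (.const 0) hp).and ((hcond.and
        ((Primrec.eq.comp (primrec_min_level.comp (Primrec.pred.comp hp)
          (Primrec.succ.comp hs)) hs).and
          (Primrec.eq.comp (primrec_provisionalCode.comp ((Primrec.fst.pair hbound).pair
            (Primrec.nat_ofDigits.comp hbound₂ .snd))) .id))).or
      (hcond.not.and
        (Primrec.eq.comp (primrec_code.comp (primrec_truncVal.comp .id hbound₂)) .id))))
  refine main.of_eq fun x => ?_
  have key : 0 < x.1.1 → x.1.2 = level (x.1.1 - 1) → bound x + 2 ≤ level x.1.1 →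
      provisionalCode x.1.1 x.1.2 (bound x) (Nat.ofDigits (bound x + 2) x.2) =
        code (codeVal x) := fun h h' hB => by
    have := provisionalCode_eval_eq (P := Nat.ofDigits X x.2) (B := bound x) ?_ hB (fun _ => h')
      (fun h0 => by omega)
    · rwa [eval_ofDigits_X, eval_ofDigits_X] at this
    · rw [eval_ofDigits_X, Nat.ofDigits_one]
      have := natDegree_ofDigits_X_le x.2
      simp only [bound]
      omega
  constructor
  · rintro (⟨-, h⟩ | ⟨h0, ⟨h, h₁, h₂⟩ | ⟨-, h⟩⟩)
    · exact ⟨_, h⟩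
    · have h₃ : x.1.2 = level (x.1.1 - 1) := by omega
      exact ⟨_, (key h0 h₃ (le_min_iff.1 h).1).symm.trans h₂⟩
    · exact ⟨_, h⟩
  · rintro ⟨n, rfl⟩
    rcases Nat.eq_zero_or_pos (code n).1.1 with h0 | h0
    · left
      refine ⟨h0, ?_⟩
      rw [code_of_fst_eq_zero h0]
      exact code_of_fst_eq_zero h0
    · right
      refine ⟨h0, ?_⟩
      have hw := code_witness h0
      by_cases h : bound (code n) + 2 ≤ min (level (code n).1.1) (bound (code n) + 2)
      · refine .inl ⟨h, by omega, ?_⟩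
        rw [key h0 hw (le_min_iff.1 h).1, codeVal_code]
      · refine .inr ⟨h, ?_⟩
        rw [truncVal_code (by simp only [le_min_iff, le_refl, and_true] at h; omega)]

theorem code_two_pow_level (p : ℕ) :
    code (2 ^ level (p + 1)) = ((p + 1, level p), [0, 1]) := by
  have hb := Nat.lt_two_pow_self (n := level (p + 1))
  have hl := lt_level (p + 1)
  have hphase : phase (2 ^ level (p + 1)) = p + 1 :=
    phase_eq le_rfl (Nat.pow_lt_pow_right (by norm_num) (level_strictMono (Nat.lt_succ_self _)))
  have hdig : Nat.digits (2 ^ level (p + 1)) (2 ^ level (p + 1)) = [0, 1] := by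
    have := Nat.digits_add (2 ^ level (p + 1)) (by omega) 0 1 (by omega) (by simp)
    rwa [zero_add, mul_one, Nat.digits_of_lt _ 1 (by norm_num) (by omega)] at this
  rw [code, hphase, hdig, if_pos ⟨by omega, by simp; omega⟩]
  rfl

theorem lt_two_pow_of_code_small {p n : ℕ} (hs : (code n).1.2 < level p)
    (hL : (code n).2.sum + (code n).2.length < level p) :
    n < (2 ^ level p) ^ level p := by
  have hb := Nat.lt_two_pow_self (n := level p)
  have hp : (code n).1.1 ≤ p := by
    rcases Nat.eq_zero_or_pos (code n).1.1 with h0 | h0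
    · omega
    · rw [code_witness h0, level_strictMono.lt_iff_lt] at hs
      omega
  calc n = Nat.ofDigits (2 ^ level (code n).1.1) (code n).2 := (codeVal_code n).symm
    _ ≤ Nat.ofDigits (2 ^ level p) (code n).2 :=
      Nat.ofDigits_monotone _
        (Nat.pow_le_pow_right (by norm_num) (level_strictMono.monotone hp))
    _ < (2 ^ level p) ^ (code n).2.length :=
      Nat.ofDigits_lt_base_pow_length (by omega) fun d hd =>
        ((List.single_le_sum (by simp) d hd).trans (Nat.le_add_right _ _)).trans_lt
          (hL.trans hb)
    _ ≤ _ := Nat.pow_le_pow_right (by omega) (by omega)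

/-- No function growing at least as fast as `x ^ log₂ x` is primitive recursive on codes. -/
theorem not_primrec_of_pow_log_le {f : ℕ → ℕ}
    (hf : ∀ᶠ x in Filter.atTop, x ^ Nat.log 2 x ≤ f x)
    {F : (ℕ × ℕ) × List ℕ → (ℕ × ℕ) × List ℕ} (hF : ∀ n, F (code n) = code (f n)) :
    ¬ Primrec F := fun hprim => by
  let y : ℕ → (ℕ × ℕ) × List ℕ := fun q => F (q.unpair, [0, 1])
  have hy : Primrec y := hprim.comp (Primrec.unpair.pair (.const [0, 1]))
  have hsize : Primrec fun q => (y q).1.2 + ((y q).2.sum + (y q).2.length) :=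
    Primrec.nat_add.comp (Primrec.snd.comp (Primrec.fst.comp hy))
      (Primrec.nat_add.comp (Primrec.nat_list_sum.comp (Primrec.snd.comp hy))
        (Primrec.list_length.comp (Primrec.snd.comp hy)))
  obtain ⟨m, hm⟩ := exists_lt_ack_of_nat_primrec (Primrec.nat_iff.1 hsize)
  obtain ⟨N, hN⟩ := Filter.eventually_atTop.1 hf
  set p := max m N
  have hlt : (y (Nat.pair (p + 1) (level p))).1.2 + ((y (Nat.pair (p + 1) (level p))).2.sum +
      (y (Nat.pair (p + 1) (level p))).2.length) < level (p + 1) :=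
    calc _ < ack m (Nat.pair (p + 1) (level p)) := hm _
      _ < ack (m + 4) (max (p + 1) (level p)) := ack_pair_lt _ _ _
      _ ≤ ack (p + 4) (level p) := by
        have := lt_level p
        rw [max_eq_right (by omega)]
        exact ack_mono_left _ (by have := le_max_left m N; omega)
      _ ≤ level (p + 1) := ack_level_le p
  have hy' : y (Nat.pair (p + 1) (level p)) = code (f (2 ^ level (p + 1))) := by
    rw [← hF, code_two_pow_level]
    simp [y]
  rw [hy'] at hlt
  have h₁ := lt_two_pow_of_code_small (p := p + 1) (n := f (2 ^ level (p + 1)))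
    (by omega) (by omega)
  have h₂ := hN (2 ^ level (p + 1)) (by
    have := lt_level (p + 1)
    have := Nat.lt_two_pow_self (n := level (p + 1))
    have := le_max_right m N
    omega)
  rw [Nat.log_pow (by norm_num)] at h₂
  omega

theorem stmt_3 : ∃ c : ℕ ≃ ℕ,
    Primrec (fun x => c (c.symm x + 1)) ∧
    PrimrecRel (fun x y : ℕ => c.symm x ≤ c.symm y) ∧
    Primrec₂ (fun x y : ℕ => c (c.symm x + c.symm y)) ∧
    Primrec₂ (fun x y : ℕ => c (c.symm x * c.symm y)) ∧
    ∀ f : ℕ → ℕ, Primrec f → (∀ᶠ x in Filter.atTop, x ^ (Nat.log 2 x) ≤ f x) →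
      ¬ Primrec (fun x => c (f (c.symm x))) := by
  obtain ⟨c, φ, ψ, hφ, hψ, hφc, hψc⟩ :=
    exists_equiv_of_primrecPred_range primrec_code code_injective primrecPred_range_code
  have hφ' : ∀ x, φ x = code (c.symm x) := fun x => by rw [← hφc, c.apply_symm_apply]
  obtain ⟨A, hA, hA'⟩ := exists_primrec_code_op Primrec.nat_add (fun P Q => P + Q)
    (fun P Q b => Polynomial.eval_add) fun P Q => (Polynomial.natDegree_add_le P Q).trans (by omega)
  obtain ⟨M, hM, hM'⟩ := exists_primrec_code_op Primrec.nat_mul (fun P Q => P * Q)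
    (fun P Q b => Polynomial.eval_mul) fun P Q => Polynomial.natDegree_mul_le
  obtain ⟨R, hR, hR'⟩ := exists_primrecRel_code_le
  refine ⟨c, ?_, ?_, ?_, ?_, fun f _ hf h => ?_⟩
  · exact (hψ.comp (hA.comp (hφ.pair (.const (code 1))))).of_eq fun x => by
      rw [hφ', hA', hψc]
  · exact (hR.comp (hφ.comp .fst) (hφ.comp .snd)).of_eq fun x => by
      rw [hφ', hφ', hR']
  · exact (hψ.comp (hA.comp ((hφ.comp .fst).pair (hφ.comp .snd)))).of_eq fun x => by
      rw [hφ', hφ', hA', hψc]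
  · exact (hψ.comp (hM.comp ((hφ.comp .fst).pair (hφ.comp .snd)))).of_eq fun x => by
      rw [hφ', hφ', hM', hψc]
  · refine not_primrec_of_pow_log_le hf (F := fun x => φ (c (f (c.symm (ψ x))))) (fun n => ?_)
      (hφ.comp (h.comp hψ))
    rw [hψc, c.symm_apply_apply, hφc]
end

section
/- There exists a bijection c : ℕ ≃ ℕ such that c ∘ S ∘ c⁻¹ is primitive recursive (where S x = x + 1), the binary relation (x, y) ↦ (c⁻¹ x ≤ c⁻¹ y) is primitive recursive, the binary functions (x, y) ↦ c (c⁻¹ x + c⁻¹ y) and (x, y) ↦ c (c⁻¹ x · c⁻¹ y) are primitive recursive, and yet c⁻¹ is not primitive recursive. (Hence the standard operations of successor, addition, multiplication, and ordering do not constitute a basis for punctual standardness.) -/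
open Primrec in
/-- Bounded universal quantification preserves primitive recursiveness of relations. -/
theorem PrimrecRel.forall_lt_left {β : Type*} [Primcodable β] {R : ℕ → β → Prop}
    (hR : PrimrecRel R) : PrimrecRel fun n y => ∀ x < n, R x y :=
  (hR.forall_mem_list.comp (list_range.comp fst) snd).of_eq (by simp)

theorem Primrec.list_replicate {α : Type*} [Primcodable α] (a : α) :
    Primrec fun n : ℕ => List.replicate n a :=
  (Primrec.list_map Primrec.list_range (Primrec.const a).to₂).of_eq fun n => by simp

theorem Primrec.exists_running_bound {f : ℕ → ℕ} (hf : Primrec f) :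
    ∃ g : ℕ → ℕ, Primrec g ∧ ∀ n, ∀ i ≤ n, f i ≤ g n := by
  refine ⟨Nat.rec (f 0) fun n r => max r (f (n + 1)),
    Primrec.nat_rec₁ _ (Primrec.nat_max.comp₂ Primrec₂.right
      (hf.comp₂ (Primrec.succ.comp₂ Primrec₂.left))), fun n => ?_⟩
  induction n with
  | zero => simp
  | succ n ih =>
    intro i hi
    rcases Nat.le_succ_iff.1 hi with h | rfl
    · exact (ih i h).trans (le_max_left _ _)
    · exact le_max_right _ _

/-- `t` is the least index at which `v` takes the value `v t`. -/
def IsLeastIndex (v : ℕ → ℕ) (t : ℕ) : Prop := ∀ s < t, v s ≠ v t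

/-- The least index at which `v` takes the value `v t`. -/
noncomputable def leastIndex (v : ℕ → ℕ) (t : ℕ) : ℕ := sInf {s | v s = v t}

section LeastIndex

variable {v : ℕ → ℕ}

theorem apply_leastIndex (t : ℕ) : v (leastIndex v t) = v t :=
  Nat.sInf_mem (s := {s | v s = v t}) ⟨t, rfl⟩

theorem leastIndex_le (t : ℕ) : leastIndex v t ≤ t :=
  Nat.sInf_le (show v t = v t from rfl)

theorem isLeastIndex_leastIndex (t : ℕ) : IsLeastIndex v (leastIndex v t) := fun _ hs h =>
  Nat.notMem_of_lt_sInf (s := {s | v s = v t}) hs (h.trans (apply_leastIndex t))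

theorem leastIndex_congr {s t : ℕ} (h : v s = v t) : leastIndex v s = leastIndex v t := by
  unfold leastIndex; rw [h]

theorem IsLeastIndex.eq_of_apply_eq {s t : ℕ} (hs : IsLeastIndex v s) (ht : IsLeastIndex v t)
    (h : v s = v t) : s = t := by
  rcases lt_trichotomy s t with hlt | heq | hlt
  · exact absurd h (ht s hlt)
  · exact heq
  · exact absurd h.symm (hs t hlt)

theorem primrecPred_isLeastIndex (hv : PrimrecRel fun x y => v x = v y) :
    PrimrecPred (IsLeastIndex v) :=
  (PrimrecRel.forall_lt_left hv.not).comp Primrec.id Primrec.id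

theorem primrec_leastIndex (hv : PrimrecRel fun x y => v x = v y) : Primrec (leastIndex v) := by
  refine Primrec.of_graph ⟨id, Primrec.id, leastIndex_le⟩ ?_
  refine PrimrecPred.of_eq (PrimrecPred.and (hv.comp Primrec.snd Primrec.fst)
    ((primrecPred_isLeastIndex hv).comp Primrec.snd)) fun p => ?_
  constructor
  · rintro ⟨h, hl⟩
    exact (isLeastIndex_leastIndex _).eq_of_apply_eq hl ((apply_leastIndex _).trans h.symm)
  · intro h
    rw [← h]
    exact ⟨apply_leastIndex _, isLeastIndex_leastIndex _⟩

variable {num : ℕ → ℕ}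

theorem infinite_isLeastIndex (hnum : ∀ n, v (num n) = n) :
    (Set.ofPred (IsLeastIndex v)).Infinite := by
  refine Set.infinite_of_injective_forall_mem (f := fun n => leastIndex v (num n)) ?_
    fun n => isLeastIndex_leastIndex _
  intro a b h
  simpa [apply_leastIndex, hnum] using congrArg v h

open Classical in
theorem primrec_nth_isLeastIndex (hv : PrimrecRel fun x y => v x = v y)
    (hp : Primrec num) (hnum : ∀ n, v (num n) = n) : Primrec (Nat.nth (IsLeastIndex v)) := by
  have hinf := infinite_isLeastIndex hnum
  obtain ⟨g, hg, hle⟩ := hp.exists_running_bound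
  refine Primrec.of_graph ⟨g, hg, fun x => ?_⟩ ?_
  · refine Nat.lt_succ_iff.1 (Nat.nth_lt_of_lt_count ?_)
    rw [Nat.count_eq_card_filter_range, ← Nat.succ_le_iff]
    calc x + 1 = ((Finset.range (x + 1)).image fun n => leastIndex v (num n)).card := by
          rw [Finset.card_image_of_injective, Finset.card_range]
          intro a b h
          simpa [apply_leastIndex, hnum] using congrArg v h
      _ ≤ _ := by
          refine Finset.card_le_card fun t ht => ?_
          obtain ⟨n, hn, rfl⟩ := Finset.mem_image.1 ht
          rw [Finset.mem_range] at hn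
          rw [Finset.mem_filter, Finset.mem_range, Nat.lt_succ_iff]
          exact ⟨(leastIndex_le _).trans (hle x n (Nat.lt_succ_iff.1 hn)),
            isLeastIndex_leastIndex _⟩
  · refine PrimrecPred.of_eq (PrimrecPred.and
      ((primrecPred_isLeastIndex hv).comp Primrec.snd)
      (Primrec.eq.comp ((Primrec.nat_count (primrecPred_isLeastIndex hv)).comp Primrec.snd)
        Primrec.fst)) fun p => ?_
    constructor
    · rintro ⟨h, hc⟩
      rw [← hc, Nat.nth_count h]
    · intro h
      rw [← h]
      exact ⟨Nat.nth_mem_of_infinite hinf _, Nat.count_nth_of_infinite hinf _⟩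

end LeastIndex

open Classical in
/-- A system of names for the natural numbers, possibly giving several names to the same number,
with primitive recursive comparison, addition and multiplication but a valuation that is not
primitive recursive, yields a copy of `ℕ` in which each number has exactly one name. -/
theorem exists_copy_of_nat_names {v num : ℕ → ℕ} {add mul : ℕ → ℕ → ℕ}
    (hle : PrimrecRel fun x y => v x ≤ v y) (hnum : Primrec num) (hvnum : ∀ n, v (num n) = n)
    (hadd : Primrec₂ add) (hvadd : ∀ x y, v (add x y) = v x + v y)
    (hmul : Primrec₂ mul) (hvmul : ∀ x y, v (mul x y) = v x * v y) (hv : ¬ Primrec v) :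
    ∃ c : ℕ ≃ ℕ,
      Primrec (fun x => c (c.symm x + 1)) ∧
      PrimrecRel (fun x y : ℕ => c.symm x ≤ c.symm y) ∧
      Primrec₂ (fun x y : ℕ => c (c.symm x + c.symm y)) ∧
      Primrec₂ (fun x y : ℕ => c (c.symm x * c.symm y)) ∧
      ¬ Primrec (c.symm : ℕ → ℕ) := by
  have heq : PrimrecRel fun x y => v x = v y :=
    PrimrecPred.of_eq (PrimrecPred.and hle hle.swap) fun p => le_antisymm_iff.symm
  have hinf := infinite_isLeastIndex hvnum
  let nth := Nat.nth (IsLeastIndex v)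
  have hnth : Primrec nth := primrec_nth_isLeastIndex heq hnum hvnum
  let code : ℕ → ℕ := fun t => Nat.count (IsLeastIndex v) (leastIndex v t)
  have hcode : Primrec code :=
    (Primrec.nat_count (primrecPred_isLeastIndex heq)).comp (primrec_leastIndex heq)
  have hcongr : ∀ {s t}, v s = v t → code s = code t := fun h => by
    simp only [code, leastIndex_congr h]
  have hnth_code : ∀ t, nth (code t) = leastIndex v t := fun t =>
    Nat.nth_count (isLeastIndex_leastIndex t)
  have hleast : ∀ x, leastIndex v (nth x) = nth x := fun x =>
    (isLeastIndex_leastIndex _).eq_of_apply_eq (Nat.nth_mem_of_infinite hinf x)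
      (apply_leastIndex _)
  let c : ℕ ≃ ℕ :=
    { toFun := fun n => code (num n)
      invFun := fun x => v (nth x)
      left_inv := fun n => by simp only [hnth_code, apply_leastIndex, hvnum]
      right_inv := fun x => by
        refine (hcongr (hvnum (v (nth x)))).trans ?_
        simp only [code, hleast]
        exact Nat.count_nth_of_infinite hinf x }
  have hsymm : ∀ x, c.symm x = v (nth x) := fun _ => rfl
  have hc : ∀ t, c (v t) = code t := fun t => hcongr (hvnum (v t))
  refine ⟨c, ?_, ?_, ?_, ?_, fun h => hv ?_⟩
  · refine (hcode.comp (hadd.comp hnth (Primrec.const (num 1)))).of_eq fun x => ?_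
    rw [← hc, hvadd, hvnum, hsymm]
  · exact hle.comp₂ (hnth.comp₂ Primrec₂.left) (hnth.comp₂ Primrec₂.right)
  · refine (hcode.comp₂ (hadd.comp₂ (hnth.comp₂ Primrec₂.left)
      (hnth.comp₂ Primrec₂.right))).of_eq fun x y => ?_
    rw [← hc, hvadd, hsymm, hsymm]
  · refine (hcode.comp₂ (hmul.comp₂ (hnth.comp₂ Primrec₂.left)
      (hnth.comp₂ Primrec₂.right))).of_eq fun x y => ?_
    rw [← hc, hvmul, hsymm, hsymm]
  · refine (h.comp hcode).of_eq fun t => ?_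
    simp only [hsymm, hnth_code, apply_leastIndex]

/-- `exists_copy_of_nat_names` for names taken from an arbitrary `Primcodable` type. -/
theorem exists_copy_of_names {α : Type*} [Primcodable α] {v : α → ℕ} {num : ℕ → α}
    {add mul : α → α → α}
    (hle : PrimrecRel fun x y => v x ≤ v y) (hnum : Primrec num) (hvnum : ∀ n, v (num n) = n)
    (hadd : Primrec₂ add) (hvadd : ∀ x y, v (add x y) = v x + v y)
    (hmul : Primrec₂ mul) (hvmul : ∀ x y, v (mul x y) = v x * v y) (hv : ¬ Primrec v) :
    ∃ c : ℕ ≃ ℕ,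
      Primrec (fun x => c (c.symm x + 1)) ∧
      PrimrecRel (fun x y : ℕ => c.symm x ≤ c.symm y) ∧
      Primrec₂ (fun x y : ℕ => c (c.symm x + c.symm y)) ∧
      Primrec₂ (fun x y : ℕ => c (c.symm x * c.symm y)) ∧
      ¬ Primrec (c.symm : ℕ → ℕ) := by
  let dec : ℕ → α := fun n => (Encodable.decode n).getD (num 0)
  have hdec : Primrec dec := Primrec.option_getD.comp Primrec.decode (Primrec.const (num 0))
  have hdec_enc : ∀ a, dec (Encodable.encode a) = a := fun a => by simp [dec]
  have hdec₁ : Primrec₂ fun x _ : ℕ => dec x := hdec.comp₂ Primrec₂.left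
  have hdec₂ : Primrec₂ fun _ y : ℕ => dec y := hdec.comp₂ Primrec₂.right
  refine exists_copy_of_nat_names (v := fun n => v (dec n))
    (num := fun n => Encodable.encode (num n))
    (add := fun x y => Encodable.encode (add (dec x) (dec y)))
    (mul := fun x y => Encodable.encode (mul (dec x) (dec y)))
    (hle.comp₂ hdec₁ hdec₂) (Primrec.encode.comp hnum) (fun n => by simp only [hdec_enc, hvnum])
    (Primrec.encode.comp₂ (hadd.comp₂ hdec₁ hdec₂)) (fun x y => by simp only [hdec_enc, hvadd])
    (Primrec.encode.comp₂ (hmul.comp₂ hdec₁ hdec₂)) (fun x y => by simp only [hdec_enc, hvmul])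
    fun h => hv ((h.comp Primrec.encode).of_eq fun a => by rw [hdec_enc])

/-- There is a primitive recursive monotone unbounded function with no primitive recursive
modulus of divergence: an inverse of the time needed to compute the Ackermann function. -/
theorem exists_slow_clock : ∃ L : ℕ → ℕ, Primrec L ∧ Monotone L ∧ (∀ n, ∃ s, n ≤ L s) ∧
    ∀ f : ℕ → ℕ, Primrec f → ∃ n, L (f n) < n := by
  classical
  have hcomp : Computable fun n => ack n n := computable₂_ack.comp Computable.id Computable.id
  obtain ⟨c, hc⟩ := Nat.Partrec.Code.exists_code.1 (Partrec.nat_iff.1 hcomp)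
  replace hc : ∀ n x, x ∈ c.eval n ↔ x = ack n n := fun n x => by simp [hc]
  have hdone : PrimrecRel fun m s : ℕ => (c.evaln s m).isSome = true := by
    have : Primrec₂ fun m s : ℕ => (c.evaln s m).isSome :=
      Primrec.option_isSome.comp (Nat.Partrec.Code.primrec_evaln.comp
        (Primrec.pair (Primrec.pair Primrec.snd (Primrec.const c)) Primrec.fst))
    exact Primrec.eq.comp this (Primrec.const true)
  let done : ℕ → ℕ → Prop := fun s n => ∀ m < n, (c.evaln s m).isSome = true
  let L : ℕ → ℕ := fun s => Nat.findGreatest (done s) s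
  have hL : ∀ s, done s (L s) := fun s =>
    Nat.findGreatest_spec (P := done s) (Nat.zero_le s) fun m hm => absurd hm (Nat.not_lt_zero m)
  have hle : ∀ {s n}, done s n → n ≤ L s := fun {s n} h => by
    refine Nat.le_findGreatest ?_ h
    rcases n with - | n
    · exact Nat.zero_le s
    · obtain ⟨x, hx⟩ := Option.isSome_iff_exists.1 (h n n.lt_succ_self)
      exact Nat.Partrec.Code.evaln_bound hx
  have hmono : ∀ {s t n}, s ≤ t → done s n → done t n := fun hst h m hm => by
    obtain ⟨x, hx⟩ := Option.isSome_iff_exists.1 (h m hm)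
    exact Option.isSome_iff_exists.2 ⟨x, Nat.Partrec.Code.evaln_mono hst hx⟩
  refine ⟨L, Primrec.nat_findGreatest Primrec.id hdone.forall_lt.swap,
    fun s t hst => hle (hmono hst (hL s)), fun n => ?_, fun f hf => ?_⟩
  · suffices ∃ s, done s n from this.imp fun s => hle
    induction n with
    | zero => exact ⟨0, fun m hm => absurd hm (Nat.not_lt_zero m)⟩
    | succ n ih =>
      obtain ⟨s, hs⟩ := ih
      obtain ⟨t, ht⟩ := Nat.Partrec.Code.evaln_complete.1 ((hc n _).2 rfl)
      refine ⟨max s t, fun m hm => ?_⟩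
      rcases Nat.lt_succ_iff_lt_or_eq.1 hm with h | rfl
      · exact hmono (le_max_left s t) hs m h
      · exact Option.isSome_iff_exists.2
          ⟨_, Nat.Partrec.Code.evaln_mono (le_max_right s t) ht⟩
  · by_contra! h
    refine not_primrec_ack_self ((Primrec.option_getD.comp
      (Nat.Partrec.Code.primrec_evaln.comp (Primrec.pair
        (Primrec.pair (hf.comp Primrec.succ) (Primrec.const c)) Primrec.id))
      (Primrec.const 0)).of_eq fun n => ?_)
    obtain ⟨x, hx⟩ := Option.isSome_iff_exists.1
      (hL (f (n + 1)) n (Nat.lt_of_succ_le (h (n + 1))))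
    have := (hc n x).1 (Nat.Partrec.Code.evaln_sound hx)
    simp [hx, this]

/-- The first stage at which the clock `L` shows more than at stage `i`. -/
noncomputable def nextStage (L : ℕ → ℕ) (i : ℕ) : ℕ := sInf {s | L i < L s}

section NextStage

variable {L : ℕ → ℕ}

theorem nextStage_congr {i j : ℕ} (h : L i = L j) : nextStage L i = nextStage L j := by
  unfold nextStage; rw [h]

theorem lt_apply_nextStage (hL : ∀ n, ∃ s, n ≤ L s) (i : ℕ) : L i < L (nextStage L i) :=
  Nat.sInf_mem (s := {s | L i < L s}) (hL (L i + 1))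

theorem nextStage_le_iff (hm : Monotone L) (hL : ∀ n, ∃ s, n ≤ L s) {i s : ℕ} :
    nextStage L i ≤ s ↔ L i < L s :=
  ⟨fun h => (lt_apply_nextStage hL i).trans_le (hm h), fun h => Nat.sInf_le h⟩

theorem primrec_min_nextStage (hp : Primrec L) (hm : Monotone L) (hL : ∀ n, ∃ s, n ≤ L s) :
    Primrec₂ fun i B => min (nextStage L i) B := by
  classical
  have hlt : PrimrecRel fun m i => L i < L m :=
    Primrec.nat_lt.comp₂ (hp.comp₂ Primrec₂.right) (hp.comp₂ Primrec₂.left)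
  refine Primrec.of_graph ⟨Prod.snd, Primrec.snd, fun p => min_le_right _ _⟩ ?_
  have hi : Primrec fun p : (ℕ × ℕ) × ℕ => p.1.1 := Primrec.fst.comp Primrec.fst
  have hB : Primrec fun p : (ℕ × ℕ) × ℕ => p.1.2 := Primrec.snd.comp Primrec.fst
  refine PrimrecPred.of_eq (PrimrecPred.and (Primrec.nat_le.comp Primrec.snd hB)
    (PrimrecPred.and (PrimrecPred.or (Primrec.nat_le.comp hB Primrec.snd)
      (hlt.comp Primrec.snd hi)) (hlt.not.forall_lt.comp Primrec.snd hi))) fun p => ?_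
  simp only [← nextStage_le_iff hm hL, not_le]
  constructor
  · rintro ⟨h₁, h₂, h₃⟩
    rcases Nat.eq_zero_or_pos p.2 with h | h
    · grind
    · have := h₃ (p.2 - 1) (by lia)
      grind
  · grind

theorem not_primrec_nextStage (hL : ∀ n, ∃ s, n ≤ L s)
    (hslow : ∀ f : ℕ → ℕ, Primrec f → ∃ n, L (f n) < n) : ¬ Primrec (nextStage L) := by
  intro h
  obtain ⟨n, hn⟩ := hslow _
    (Primrec.nat_iterate Primrec.id (Primrec.const 0) (h.comp Primrec.snd).to₂)
  refine hn.not_ge ?_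
  clear hn
  induction n with
  | zero => exact Nat.zero_le _
  | succ n ih =>
    simp only [id, Function.iterate_succ_apply'] at ih ⊢
    exact ih.trans_lt (lt_apply_nextStage hL _)

end NextStage

/-- The value at `a` of the polynomial that is the sum of the monomials `X ^ e`, `e ∈ P`. -/
def sumPow (a : ℕ) (P : List ℕ) : ℕ := (P.map (a ^ ·)).sum

section SumPow

theorem sumPow_append (a : ℕ) (P Q : List ℕ) : sumPow a (P ++ Q) = sumPow a P + sumPow a Q := by
  simp [sumPow]

theorem sumPow_replicate_zero (a n : ℕ) : sumPow a (List.replicate n 0) = n := by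
  simp [sumPow]

theorem sumPow_flatMap (a : ℕ) (P Q : List ℕ) :
    sumPow a (P.flatMap fun e => Q.map (e + ·)) = sumPow a P * sumPow a Q := by
  induction P with
  | nil => simp [sumPow]
  | cons e P ih =>
    rw [List.flatMap_cons, sumPow_append, ih]
    simp [sumPow, add_mul, List.map_map, Function.comp_def, pow_add, List.sum_map_mul_left]

theorem primrec_sumPow : Primrec₂ sumPow :=
  (Primrec.list_foldr Primrec.snd (Primrec.const 0)
    (h := fun p q => p.1 ^ q.1 + q.2)
    (Primrec.nat_add.comp (Primrec.nat_pow.comp (Primrec.fst.comp Primrec.fst)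
      (Primrec.fst.comp Primrec.snd)) (Primrec.snd.comp Primrec.snd))).of_eq fun p => by
    induction p.2 with
    | nil => simp [sumPow]
    | cons e P ih => simp [sumPow, ih] at ih ⊢

theorem sumPow_eq_sum_range (a : ℕ) {P : List ℕ} {N : ℕ} (h : ∀ e ∈ P, e < N) :
    sumPow a P = ∑ e ∈ Finset.range N, P.count e * a ^ e := by
  rw [sumPow, Finset.sum_list_map_count]
  simp only [smul_eq_mul]
  refine Finset.sum_subset (fun e he => ?_) fun e _ he => ?_
  · simpa using h e (by simpa using he)
  · rw [List.count_eq_zero_of_not_mem (by simpa using he), zero_mul]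

theorem sign_mul_add {x g d : ℤ} (h : |d| < x) :
    SignType.sign (x * g + d) =
      if SignType.sign g = 0 then SignType.sign d else SignType.sign g := by
  obtain ⟨h₁, h₂⟩ := abs_lt.1 h
  rcases lt_trichotomy g 0 with hg | rfl | hg
  · rw [sign_neg hg, sign_neg (by nlinarith)]
    rfl
  · simp
  · rw [sign_pos hg, sign_pos (by nlinarith)]
    rfl

/-- The sign of a polynomial does not change beyond a bound on its coefficients. -/
theorem sign_sum_range_eq (N : ℕ) {d : ℕ → ℤ} {x y : ℤ} (hx : ∀ e, |d e| < x)
    (hy : ∀ e, |d e| < y) :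
    SignType.sign (∑ e ∈ Finset.range N, d e * x ^ e) =
      SignType.sign (∑ e ∈ Finset.range N, d e * y ^ e) := by
  induction N generalizing d with
  | zero => simp
  | succ N ih =>
    have step : ∀ z : ℤ, ∑ e ∈ Finset.range (N + 1), d e * z ^ e =
        z * ∑ e ∈ Finset.range N, d (e + 1) * z ^ e + d 0 := fun z => by
      rw [Finset.sum_range_succ', Finset.mul_sum]
      simp only [pow_zero, mul_one, pow_succ]
      congr 1
      exact Finset.sum_congr rfl fun e _ => by ring
    rw [step, step, sign_mul_add (hx 0), sign_mul_add (hy 0),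
      ih (fun e => hx (e + 1)) fun e => hy (e + 1)]

theorem sumPow_le_sumPow_iff {P Q : List ℕ} {x y : ℕ} (hx : P.length + Q.length < x)
    (hy : P.length + Q.length < y) :
    sumPow x P ≤ sumPow x Q ↔ sumPow y P ≤ sumPow y Q := by
  obtain ⟨N, hN⟩ : ∃ N, ∀ e ∈ P ++ Q, e < N :=
    ⟨(P ++ Q).sum + 1, fun e he => Nat.lt_succ_iff.2 (List.le_sum_of_mem he)⟩
  have hbound : ∀ z : ℕ, P.length + Q.length < z →
      ∀ e, |((Q.count e : ℤ) - P.count e)| < z := fun z hz e => by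
    have := List.count_le_length (a := e) (l := P)
    have := List.count_le_length (a := e) (l := Q)
    rw [abs_lt]
    lia
  have hsub : ∀ z : ℕ, sumPow z P ≤ sumPow z Q ↔
      0 ≤ SignType.sign
        (∑ e ∈ Finset.range N, ((Q.count e : ℤ) - P.count e) * (z : ℤ) ^ e) := fun z => by
    rw [sign_nonneg_iff, sumPow_eq_sum_range z fun e he => hN e (List.mem_append_left Q he),
      sumPow_eq_sum_range z fun e he => hN e (List.mem_append_right P he)]
    simp only [sub_mul, Finset.sum_sub_distrib, sub_nonneg]
    exact_mod_cast Iff.rfl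
  rw [hsub, hsub, sign_sum_range_eq N (hbound x hx) (hbound y hy)]

end SumPow

/-- The number named by `(i, P)`: the polynomial with monomials `P` at the stage following `i`. -/
noncomputable def nameVal (L : ℕ → ℕ) (t : ℕ × List ℕ) : ℕ := sumPow (nextStage L t.1) t.2

open Classical in
/-- Monomials naming, with respect to the stage `j ≥ t.1`, the number named by `t`. -/
noncomputable def rebase (L : ℕ → ℕ) (t : ℕ × List ℕ) (j : ℕ) : List ℕ :=
  if L t.1 < L j then List.replicate (sumPow (min (nextStage L t.1) j) t.2) 0 else t.2

section Names

variable {L : ℕ → ℕ}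

theorem sumPow_rebase (hm : Monotone L) (hL : ∀ n, ∃ s, n ≤ L s) {t : ℕ × List ℕ} {j : ℕ}
    (h : t.1 ≤ j) : sumPow (nextStage L j) (rebase L t j) = nameVal L t := by
  unfold rebase nameVal
  split_ifs with hlt
  · rw [sumPow_replicate_zero, min_eq_left ((nextStage_le_iff hm hL).2 hlt)]
  · rw [nextStage_congr (le_antisymm (hm h) (not_lt.1 hlt))]

theorem primrec_rebase (hp : Primrec L) (hm : Monotone L) (hL : ∀ n, ∃ s, n ≤ L s) :
    Primrec₂ (rebase L) := by
  classical
  have hi : Primrec fun p : (ℕ × List ℕ) × ℕ => p.1.1 := Primrec.fst.comp Primrec.fst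
  have hP : Primrec fun p : (ℕ × List ℕ) × ℕ => p.1.2 := Primrec.snd.comp Primrec.fst
  exact (Primrec.ite (Primrec.nat_lt.comp (hp.comp hi) (hp.comp Primrec.snd))
    ((Primrec.list_replicate 0).comp (primrec_sumPow.comp
      ((primrec_min_nextStage hp hm hL).comp hi Primrec.snd) hP)) hP).of_eq fun p => by
    simp only [rebase]

theorem primrecRel_nameVal_le (hp : Primrec L) (hm : Monotone L) (hL : ∀ n, ∃ s, n ≤ L s) :
    PrimrecRel fun x y => nameVal L x ≤ nameVal L y := by
  have hmax : Primrec₂ fun x y : ℕ × List ℕ => max x.1 y.1 :=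
    Primrec.nat_max.comp₂ (Primrec.fst.comp₂ Primrec₂.left) (Primrec.fst.comp₂ Primrec₂.right)
  have hP : Primrec₂ fun x y : ℕ × List ℕ => rebase L x (max x.1 y.1) :=
    (primrec_rebase hp hm hL).comp₂ Primrec₂.left hmax
  have hQ : Primrec₂ fun x y : ℕ × List ℕ => rebase L y (max x.1 y.1) :=
    (primrec_rebase hp hm hL).comp₂ Primrec₂.right hmax
  have hB : Primrec₂ fun x y : ℕ × List ℕ => (rebase L x (max x.1 y.1)).length +
      (rebase L y (max x.1 y.1)).length + 1 :=
    Primrec.succ.comp₂ (Primrec.nat_add.comp₂ (Primrec.list_length.comp₂ hP)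
      (Primrec.list_length.comp₂ hQ))
  have ha := (primrec_min_nextStage hp hm hL).comp₂ hmax hB
  refine PrimrecRel.of_eq
    (Primrec.nat_le.comp₂ (primrec_sumPow.comp₂ ha hP) (primrec_sumPow.comp₂ ha hQ))
    fun x y => ?_
  rw [← sumPow_rebase hm hL (le_max_left x.1 y.1), ← sumPow_rebase hm hL (le_max_right x.1 y.1)]
  rcases le_total (nextStage L (max x.1 y.1)) ((rebase L x (max x.1 y.1)).length +
      (rebase L y (max x.1 y.1)).length + 1) with h | h
  · rw [min_eq_left h]
  · rw [min_eq_right h]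
    exact sumPow_le_sumPow_iff (Nat.lt_succ_self _) h

theorem exists_primrec_nameVal_add (hp : Primrec L) (hm : Monotone L)
    (hL : ∀ n, ∃ s, n ≤ L s) : ∃ add : ℕ × List ℕ → ℕ × List ℕ → ℕ × List ℕ,
      Primrec₂ add ∧ ∀ x y, nameVal L (add x y) = nameVal L x + nameVal L y := by
  have hmax : Primrec₂ fun x y : ℕ × List ℕ => max x.1 y.1 :=
    Primrec.nat_max.comp₂ (Primrec.fst.comp₂ Primrec₂.left) (Primrec.fst.comp₂ Primrec₂.right)
  refine ⟨fun x y => (max x.1 y.1, rebase L x (max x.1 y.1) ++ rebase L y (max x.1 y.1)),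
    Primrec₂.pair.comp₂ hmax (Primrec.list_append.comp₂
      ((primrec_rebase hp hm hL).comp₂ Primrec₂.left hmax)
      ((primrec_rebase hp hm hL).comp₂ Primrec₂.right hmax)), fun x y => ?_⟩
  rw [← sumPow_rebase hm hL (le_max_left x.1 y.1), ← sumPow_rebase hm hL (le_max_right x.1 y.1)]
  exact sumPow_append _ _ _

theorem exists_primrec_nameVal_mul (hp : Primrec L) (hm : Monotone L)
    (hL : ∀ n, ∃ s, n ≤ L s) : ∃ mul : ℕ × List ℕ → ℕ × List ℕ → ℕ × List ℕ,
      Primrec₂ mul ∧ ∀ x y, nameVal L (mul x y) = nameVal L x * nameVal L y := by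
  have hmax : Primrec₂ fun x y : ℕ × List ℕ => max x.1 y.1 :=
    Primrec.nat_max.comp₂ (Primrec.fst.comp₂ Primrec₂.left) (Primrec.fst.comp₂ Primrec₂.right)
  have hconv : Primrec₂ fun P Q : List ℕ => P.flatMap fun e => Q.map (e + ·) :=
    Primrec.list_flatMap Primrec.fst (Primrec.list_map (Primrec.snd.comp Primrec.fst)
      (Primrec.nat_add.comp (Primrec.snd.comp Primrec.fst) Primrec.snd))
  refine ⟨fun x y => (max x.1 y.1,
      (rebase L x (max x.1 y.1)).flatMap fun e => (rebase L y (max x.1 y.1)).map (e + ·)),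
    Primrec₂.pair.comp₂ hmax (hconv.comp₂
      ((primrec_rebase hp hm hL).comp₂ Primrec₂.left hmax)
      ((primrec_rebase hp hm hL).comp₂ Primrec₂.right hmax)), fun x y => ?_⟩
  rw [← sumPow_rebase hm hL (le_max_left x.1 y.1), ← sumPow_rebase hm hL (le_max_right x.1 y.1)]
  exact sumPow_flatMap _ _ _

end Names

theorem stmt_4 : ∃ c : ℕ ≃ ℕ,
    Primrec (fun x => c (c.symm x + 1)) ∧
    PrimrecRel (fun x y : ℕ => c.symm x ≤ c.symm y) ∧
    Primrec₂ (fun x y : ℕ => c (c.symm x + c.symm y)) ∧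
    Primrec₂ (fun x y : ℕ => c (c.symm x * c.symm y)) ∧
    ¬ Primrec (c.symm : ℕ → ℕ) := by
  obtain ⟨L, hp, hm, hL, hslow⟩ := exists_slow_clock
  obtain ⟨add, hadd, hvadd⟩ := exists_primrec_nameVal_add hp hm hL
  obtain ⟨mul, hmul, hvmul⟩ := exists_primrec_nameVal_mul hp hm hL
  refine exists_copy_of_names (v := nameVal L) (num := fun n => (0, List.replicate n 0))
    (primrecRel_nameVal_le hp hm hL)
    (Primrec.pair (Primrec.const 0) (Primrec.list_replicate 0))
    (fun n => sumPow_replicate_zero _ n) hadd hvadd hmul hvmul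
    fun h => not_primrec_nextStage hL hslow ?_
  exact (h.comp (Primrec.pair Primrec.id (Primrec.const [1]))).of_eq fun i => by
    simp [nameVal, sumPow]
end

section
/- For every finite set P of prime numbers there exists a bijection c : ℕ ≃ ℕ such that c ∘ S ∘ c⁻¹ is primitive recursive (where S x = x + 1), and for all natural numbers a, b with a > 0, the conjugate c ∘ (x ↦ a·x + b) ∘ c⁻¹ is primitive recursive if and only if every prime divisor of a belongs to P. -/
/-- Bounded existential quantification with parameters of any type is primitive recursive. -/
theorem PrimrecPred.exists_lt_comp {α : Type*} [Primcodable α] {f : α → ℕ} {R : ℕ → α → Prop}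
    (hf : Primrec f) (hR : PrimrecRel R) : PrimrecPred fun a => ∃ x < f a, R x a :=
  (hR.exists_mem_list.comp (Primrec.list_range.comp hf) Primrec.id).of_eq (by simp)

/-- Bounded universal quantification with parameters of any type is primitive recursive. -/
theorem PrimrecPred.forall_lt_comp {α : Type*} [Primcodable α] {f : α → ℕ} {R : ℕ → α → Prop}
    (hf : Primrec f) (hR : PrimrecRel R) : PrimrecPred fun a => ∀ x < f a, R x a :=
  (hR.forall_mem_list.comp (Primrec.list_range.comp hf) Primrec.id).of_eq (by simp)

theorem PrimrecRel.nat_dvd : PrimrecRel ((· ∣ ·) : ℕ → ℕ → Prop) :=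
  (Primrec.eq.comp (Primrec.nat_mod.comp Primrec.snd Primrec.fst)
    (Primrec.const 0)).of_eq fun _ => (Nat.dvd_iff_mod_eq_zero ..).symm

/-- There is a sparse sequence with primitive recursive graph that is not bounded by any
primitive recursive function. -/
theorem exists_sparse_sequence : ∃ N : ℕ → ℕ, (∀ j k, j < k → (N j + 1) ^ 2 ≤ N k) ∧
    PrimrecRel (fun k m => N k = m) ∧ ∀ h : ℕ → ℕ, Primrec h → ∃ k, h k < N k := by
  have hcomp : Computable fun k => ack k k := computable₂_ack.comp Computable.id Computable.id
  obtain ⟨c, hc⟩ := Nat.Partrec.Code.exists_code.1 (Partrec.nat_iff.1 hcomp)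
  have hev : ∀ k, ∃ s, ack k k ∈ c.evaln s k := fun k =>
    Nat.Partrec.Code.evaln_complete.1 (by rw [hc]; exact Part.mem_some _)
  choose s hs using hev
  have hsound : ∀ {t k x}, x ∈ c.evaln t k → x = ack k k := fun {t k x} hx => by
    have := Nat.Partrec.Code.evaln_sound hx
    rw [hc] at this
    exact Part.mem_some_iff.1 this
  let ok : ℕ → ℕ → Prop := fun t k => ∀ j < k + 1, (c.evaln t j).isSome = true
  have hok : ∀ k, ∃ t, ok t k := fun k => by
    refine ⟨∑ j ∈ Finset.range (k + 1), s j, fun j hj => ?_⟩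
    have hle : s j ≤ ∑ j ∈ Finset.range (k + 1), s j :=
      Finset.single_le_sum (f := s) (fun _ _ => Nat.zero_le _) (Finset.mem_range.2 hj)
    exact Option.isSome_iff_exists.2 ⟨_, Nat.Partrec.Code.evaln_mono hle (hs j)⟩
  classical
  let T : ℕ → ℕ := fun k => Nat.find (hok k)
  have hT : ∀ k, ok (T k) k := fun k => Nat.find_spec (hok k)
  have hTmono : Monotone T := fun j k hjk =>
    Nat.find_min' (hok j) fun i hi => hT k i (by omega)
  let N : ℕ → ℕ := fun k => 2 ^ 3 ^ (T k + k + 1)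
  have hTN : ∀ k, T k ≤ N k := fun k => by
    have h1 : T k + k + 1 < 3 ^ (T k + k + 1) := Nat.lt_pow_self (by norm_num)
    have h2 : 3 ^ (T k + k + 1) < N k := Nat.lt_pow_self (by norm_num)
    omega
  have hokP : PrimrecRel ok := by
    refine PrimrecPred.forall_lt_comp (Primrec.succ.comp Primrec.snd) ?_
    refine Primrec.eq.comp (Primrec.option_isSome.comp (Nat.Partrec.Code.primrec_evaln.comp
      (Primrec.pair (Primrec.pair (Primrec.fst.comp Primrec.snd) (Primrec.const c)) Primrec.fst)))
      (Primrec.const true)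
  have hTP : PrimrecRel fun k t => T k = t := by
    have : PrimrecRel fun k t => ok t k ∧ ∀ r < t, ¬ ok r k := by
      refine PrimrecPred.and (hokP.comp Primrec.snd Primrec.fst) ?_
      refine PrimrecPred.forall_lt_comp Primrec.snd (PrimrecPred.not ?_)
      exact hokP.comp Primrec.fst (Primrec.fst.comp Primrec.snd)
    exact this.of_eq fun k t => (Nat.find_eq_iff (hok k)).symm
  refine ⟨N, fun j k hjk => ?_, ?_, fun h hh => ?_⟩
  · have hjT := hTmono hjk.le
    have h3 : 3 ≤ N j := by
      have h1 : 3 ^ 1 ≤ 3 ^ (T j + j + 1) := Nat.pow_le_pow_right (by norm_num) (by omega)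
      have h2 : 2 ^ 3 ≤ N j := Nat.pow_le_pow_right (by norm_num) (by omega)
      omega
    have hcube : N j ^ 3 ≤ N k := by
      rw [← pow_mul, ← pow_succ]
      exact Nat.pow_le_pow_right (by norm_num) (Nat.pow_le_pow_right (by norm_num) (by omega))
    refine le_trans ?_ hcube
    nlinarith [Nat.mul_le_mul h3 (le_refl (N j * N j)), Nat.mul_le_mul h3 (le_refl (N j))]
  · have : PrimrecRel fun k m => ∃ t < m + 1, T k = t ∧ 2 ^ 3 ^ (t + k + 1) = m := by
      refine PrimrecPred.exists_lt_comp (Primrec.succ.comp Primrec.snd) (PrimrecPred.and ?_ ?_)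
      · exact hTP.comp (Primrec.fst.comp Primrec.snd) Primrec.fst
      · refine Primrec.eq.comp (Primrec.nat_pow.comp (Primrec.const 2)
          (Primrec.nat_pow.comp (Primrec.const 3) (Primrec.succ.comp
            (Primrec.nat_add.comp Primrec.fst (Primrec.fst.comp Primrec.snd)))))
          (Primrec.snd.comp Primrec.snd)
    refine this.of_eq fun k m => ⟨?_, ?_⟩
    · rintro ⟨t, -, rfl, h⟩
      exact h
    · rintro rfl
      exact ⟨T k, Nat.lt_succ_of_le (hTN k), rfl, rfl⟩
  · by_contra! hle
    refine not_primrec_ack_self ?_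
    have hP : Primrec fun k => (c.evaln (h k) k).getD 0 :=
      Primrec.option_getD.comp (Nat.Partrec.Code.primrec_evaln.comp
        (Primrec.pair (Primrec.pair hh (Primrec.const c)) Primrec.id)) (Primrec.const 0)
    refine hP.of_eq fun k => ?_
    obtain ⟨x, hx⟩ := Option.isSome_iff_exists.1 (hT k k (Nat.lt_succ_self k))
    have hx' := Nat.Partrec.Code.evaln_mono ((hTN k).trans (hle k)) hx
    rw [Option.mem_def.1 hx', ← hsound hx, Option.getD_some]

/-- Two distinct representations of the same number as `u * N k + v` with `u ≠ 0` in one of them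
bound `N k` by their coefficients. -/
theorem sparse_le_of_collision {N : ℕ → ℕ} (hN : ∀ j k, j < k → (N j + 1) ^ 2 ≤ N k)
    {k u v k' u' v' b : ℕ} (hu : u ≠ 0) (hub : u ≤ b) (hvb : v ≤ b) (hub' : u' ≤ b)
    (hvb' : v' ≤ b) (hne : ¬ (k = k' ∧ u = u' ∧ v = v'))
    (heq : u * N k + v = u' * N k' + v') : N k ≤ b * b + b := by
  by_contra! hlt
  have hu1 : 1 ≤ u := Nat.one_le_iff_ne_zero.2 hu
  have hNw : N k ≤ u * N k + v := by nlinarith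
  rcases lt_trichotomy k k' with hk | rfl | hk
  · rcases Nat.eq_zero_or_pos u' with rfl | hu'
    · nlinarith
    · have := hN k k' hk
      have h1 : N k' ≤ u' * N k' := Nat.le_mul_of_pos_left _ hu'
      have h2 : u * N k ≤ b * N k := Nat.mul_le_mul_right _ hub
      have h3 : b * N k ≤ N k * N k := Nat.mul_le_mul_right _ (by nlinarith)
      nlinarith
  · rcases lt_trichotomy u u' with h | rfl | h
    · have := Nat.mul_le_mul_right (N k) (Nat.succ_le_of_lt h)
      nlinarith
    · exact hne ⟨rfl, rfl, by omega⟩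
    · have := Nat.mul_le_mul_right (N k) (Nat.succ_le_of_lt h)
      nlinarith
  · have h1 := hN k' k hk
    have h2 : u' * N k' ≤ b * N k' := Nat.mul_le_mul_right _ hub'
    rcases le_or_gt (N k') b with h | h
    · have := Nat.mul_le_mul_left b h
      nlinarith
    · have := Nat.mul_le_mul_right (N k') h.le
      nlinarith

/-- A primitive recursive notation system `val` for `ℕ`, whose equality is controlled by its graph,
yields a bijection `c` for which primitive recursion on the copy is primitive recursion on
notations. -/
theorem exists_equiv_primrec_conj_iff {val g : ℕ → ℕ} {β : ℕ → ℕ → ℕ}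
    (hval : PrimrecRel fun x w => val x = w) (hg : Primrec g) (hgm : Monotone g)
    (hvg : ∀ n, val (g n) = n) (hβ : Primrec₂ β)
    (hcol : ∀ x y, x ≠ y → val x = val y → val x ≤ β x y) :
    ∃ c : ℕ ≃ ℕ, ∀ f : ℕ → ℕ, Primrec (fun x => c (f (c.symm x))) ↔
      ∃ F : ℕ → ℕ, Primrec F ∧ ∀ x, val (F x) = f (val x) := by
  classical
  have hE : PrimrecRel fun x y => val x = val y := by
    have : PrimrecRel fun x y => x = y ∨ ∃ w < β x y + 1, val x = w ∧ val y = w := by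
      refine PrimrecPred.or Primrec.eq
        (PrimrecPred.exists_lt_comp (Primrec.succ.comp hβ) (PrimrecPred.and ?_ ?_))
      · exact hval.comp (Primrec.fst.comp Primrec.snd) Primrec.fst
      · exact hval.comp (Primrec.snd.comp Primrec.snd) Primrec.fst
    refine this.of_eq fun x y => ⟨?_, fun h => ?_⟩
    · rintro (rfl | ⟨w, -, h1, h2⟩)
      · rfl
      · rw [h1, h2]
    · by_cases hxy : x = y
      · exact Or.inl hxy
      · exact Or.inr ⟨val x, Nat.lt_succ_of_le (hcol x y hxy h), rfl, h.symm⟩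
  let R : ℕ → Prop := fun x => ∀ y < x, val y ≠ val x
  have hR : PrimrecPred R := PrimrecPred.forall_lt_comp Primrec.id hE.not
  have hex : ∀ w, ∃ x, val x = w := fun w => ⟨g w, hvg w⟩
  let least : ℕ → ℕ := fun w => Nat.find (hex w)
  have hleast : ∀ w, val (least w) = w := fun w => Nat.find_spec (hex w)
  have hRleast : ∀ w, R (least w) := fun w y hy => by
    rw [hleast]
    exact Nat.find_min (hex w) hy
  have hleastR : ∀ x, R x → least (val x) = x := fun x hx =>
    (Nat.find_eq_iff (hex (val x))).2 ⟨rfl, hx⟩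
  have hleast_inj : Function.Injective least := Function.LeftInverse.injective hleast
  have hinf : (Set.ofPred R).Infinite :=
    (Set.infinite_range_of_injective hleast_inj).mono (by
      rintro _ ⟨w, rfl⟩
      exact hRleast w)
  have hnth : ∀ n, Nat.nth R n ≤ g n := fun n => by
    refine Nat.lt_succ_iff.1 (Nat.nth_lt_of_lt_count ?_)
    rw [Nat.count_eq_card_filter_range]
    have hsub : (Finset.range (n + 1)).image least ⊆ (Finset.range (g n + 1)).filter R := by
      intro x hx
      obtain ⟨w, hw, rfl⟩ := Finset.mem_image.1 hx
      refine Finset.mem_filter.2 ⟨Finset.mem_range.2 ?_, hRleast w⟩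
      have h1 : least w ≤ g w := Nat.find_min' (hex w) (hvg w)
      have h2 : g w ≤ g n := hgm (by simpa [Nat.lt_succ_iff] using hw)
      omega
    have := Finset.card_le_card hsub
    rw [Finset.card_image_of_injective _ hleast_inj, Finset.card_range] at this
    exact this
  have hcount : Primrec (Nat.count R) := Primrec.nat_count hR
  have hnthP : Primrec (Nat.nth R) := by
    refine Primrec.of_graph ⟨g, hg, hnth⟩ ?_
    have : PrimrecRel fun n x => R x ∧ Nat.count R x = n :=
      PrimrecPred.and (hR.comp Primrec.snd)
        (Primrec.eq.comp (hcount.comp Primrec.snd) Primrec.fst)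
    refine this.of_eq fun n x => ⟨?_, ?_⟩
    · rintro ⟨hx, rfl⟩
      exact Nat.nth_count hx
    · rintro rfl
      exact ⟨Nat.nth_mem_of_infinite hinf n, Nat.count_nth_of_infinite hinf n⟩
  have hcanonP : Primrec fun x => least (val x) := by
    refine Primrec.of_graph ⟨id, Primrec.id, fun x => Nat.find_min' (hex _) rfl⟩ ?_
    have : PrimrecRel fun x y => val x = val y ∧ R y :=
      PrimrecPred.and hE (hR.comp Primrec.snd)
    refine this.of_eq fun x y => ⟨?_, ?_⟩
    · rintro ⟨h, hy⟩
      rw [h, hleastR y hy]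
    · rintro rfl
      exact ⟨(hleast _).symm, hRleast _⟩
  let c : ℕ ≃ ℕ :=
    { toFun := fun w => Nat.count R (least w)
      invFun := fun n => val (Nat.nth R n)
      left_inv := fun w => by
        change val (Nat.nth R (Nat.count R (least w))) = w
        rw [Nat.nth_count (hRleast w), hleast]
      right_inv := fun n => by
        change Nat.count R (least (val (Nat.nth R n))) = n
        rw [hleastR _ (Nat.nth_mem_of_infinite hinf n), Nat.count_nth_of_infinite hinf] }
  have hcval : Primrec fun x => c (val x) := hcount.comp hcanonP
  refine ⟨c, fun f => ⟨fun h => ?_, ?_⟩⟩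
  · refine ⟨_, hnthP.comp (h.comp hcval), fun x => ?_⟩
    change c.symm _ = _
    simp
  · rintro ⟨F, hF, hFf⟩
    refine (hcval.comp (hF.comp hnthP)).of_eq fun x => ?_
    rw [hFf]
    rfl

/-- If the prime divisors of `a ≠ 0` divide `q`, then `a ∣ q ^ a`. -/
theorem Nat.dvd_pow_self_of_forall_prime {a q : ℕ} (ha : a ≠ 0)
    (h : ∀ p, p.Prime → p ∣ a → p ∣ q) : a ∣ q ^ a := by
  refine (Nat.dvd_iff_prime_pow_dvd_dvd _ _).2 fun p k hp hpk => ?_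
  rcases Nat.eq_zero_or_pos k with rfl | hk
  · simp
  · have hka : k ≤ a :=
      (Nat.lt_pow_self hp.one_lt).le.trans (Nat.le_of_dvd (Nat.pos_of_ne_zero ha) hpk)
    have hpq := h p hp ((dvd_pow_self p hk.ne').trans hpk)
    exact (pow_dvd_pow_of_dvd hpq k).trans (pow_dvd_pow q hka)

/-- The number denoted by the triple `(k, u, v)`: the coefficient `u` is used only if all its
prime divisors divide `q`, that is, if `u ∣ q ^ u`. -/
def smoothValue (q : ℕ) (N : ℕ → ℕ) (k u v : ℕ) : ℕ :=
  (if u ∣ q ^ u then u else 0) * N k + v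

/-- `smoothValue` on coded triples. -/
def smoothVal (q : ℕ) (N : ℕ → ℕ) (x : ℕ) : ℕ :=
  smoothValue q N x.unpair.1 x.unpair.2.unpair.1 x.unpair.2.unpair.2

/-- The code of a triple. -/
def tripleCode (k u v : ℕ) : ℕ := Nat.pair k (Nat.pair u v)

theorem Primrec.tripleCode {α : Type*} [Primcodable α] {f g h : α → ℕ} (hf : Primrec f)
    (hg : Primrec g) (hh : Primrec h) : Primrec fun a => tripleCode (f a) (g a) (h a) :=
  Primrec₂.natPair.comp hf (Primrec₂.natPair.comp hg hh)

theorem smoothVal_tripleCode (q : ℕ) (N : ℕ → ℕ) (k u v : ℕ) :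
    smoothVal q N (tripleCode k u v) = smoothValue q N k u v := by
  simp [smoothVal, tripleCode]

theorem pos_of_dvd_pow_self {q u : ℕ} (h : u ∣ q ^ u) : u ≠ 0 := by
  rintro rfl
  simp at h

theorem primrec_unpair_fst : Primrec fun x : ℕ => x.unpair.1 :=
  Primrec.fst.comp Primrec.unpair

theorem primrec_unpair_snd_fst : Primrec fun x : ℕ => x.unpair.2.unpair.1 :=
  primrec_unpair_fst.comp (Primrec.snd.comp Primrec.unpair)

theorem primrec_unpair_snd_snd : Primrec fun x : ℕ => x.unpair.2.unpair.2 :=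
  Primrec.snd.comp (Primrec.unpair.comp (Primrec.snd.comp Primrec.unpair))

theorem primrecPred_dvd_pow_self (q : ℕ) : PrimrecPred fun u : ℕ => u ∣ q ^ u :=
  PrimrecRel.nat_dvd.comp Primrec.id (Primrec.nat_pow.comp (Primrec.const q) Primrec.id)

theorem primrecRel_smoothVal (q : ℕ) {N : ℕ → ℕ} (hN : PrimrecRel fun k m => N k = m) :
    PrimrecRel fun x w => smoothVal q N x = w := by
  have hsm : PrimrecPred fun p : ℕ × ℕ => p.1.unpair.2.unpair.1 ∣ q ^ p.1.unpair.2.unpair.1 :=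
    (primrecPred_dvd_pow_self q).comp (primrec_unpair_snd_fst.comp Primrec.fst)
  have : PrimrecRel fun x w : ℕ =>
      (¬ x.unpair.2.unpair.1 ∣ q ^ x.unpair.2.unpair.1 ∧ x.unpair.2.unpair.2 = w) ∨
      (x.unpair.2.unpair.1 ∣ q ^ x.unpair.2.unpair.1 ∧ ∃ m < w + 1, N x.unpair.1 = m ∧
        x.unpair.2.unpair.1 * m + x.unpair.2.unpair.2 = w) := by
    refine PrimrecPred.or (PrimrecPred.and hsm.not
      (Primrec.eq.comp (primrec_unpair_snd_snd.comp Primrec.fst) Primrec.snd))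
      (PrimrecPred.and hsm (PrimrecPred.exists_lt_comp (Primrec.succ.comp Primrec.snd)
        (PrimrecPred.and ?_ ?_)))
    · exact hN.comp (primrec_unpair_fst.comp (Primrec.fst.comp Primrec.snd)) Primrec.fst
    · exact Primrec.eq.comp (Primrec.nat_add.comp
        (Primrec.nat_mul.comp (primrec_unpair_snd_fst.comp (Primrec.fst.comp Primrec.snd))
          Primrec.fst) (primrec_unpair_snd_snd.comp (Primrec.fst.comp Primrec.snd)))
        (Primrec.snd.comp Primrec.snd)
  refine this.of_eq fun x w => ?_
  by_cases h : x.unpair.2.unpair.1 ∣ q ^ x.unpair.2.unpair.1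
  · have hu := pos_of_dvd_pow_self h
    simp only [smoothVal, smoothValue, h, not_true, false_and, true_and, false_or, if_true]
    refine ⟨?_, fun hw => ⟨_, ?_, rfl, hw⟩⟩
    · rintro ⟨m, -, rfl, h⟩
      exact h
    · have := Nat.le_mul_of_pos_left (N x.unpair.1) (Nat.pos_of_ne_zero hu)
      omega
  · simp [smoothVal, smoothValue, h]

theorem smoothVal_le_of_collision {q : ℕ} {N : ℕ → ℕ}
    (hN : ∀ j k, j < k → (N j + 1) ^ 2 ≤ N k) {x y : ℕ} (hxy : x ≠ y)
    (h : smoothVal q N x = smoothVal q N y) :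
    smoothVal q N x ≤ (x + y) * ((x + y) * (x + y) + (x + y)) + (x + y) := by
  have bound : ∀ z : ℕ, z.unpair.2.unpair.1 ≤ z ∧ z.unpair.2.unpair.2 ≤ z := fun z =>
    ⟨(Nat.unpair_left_le _).trans (Nat.unpair_right_le _),
      (Nat.unpair_right_le _).trans (Nat.unpair_right_le _)⟩
  obtain ⟨hxu, hxv⟩ := bound x
  obtain ⟨hyu, hyv⟩ := bound y
  by_cases hx : x.unpair.2.unpair.1 ∣ q ^ x.unpair.2.unpair.1
  · have hu := pos_of_dvd_pow_self hx
    have hval : smoothVal q N x = x.unpair.2.unpair.1 * N x.unpair.1 + x.unpair.2.unpair.2 := by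
      simp [smoothVal, smoothValue, hx]
    have hle : N x.unpair.1 ≤ (x + y) * (x + y) + (x + y) := by
      refine sparse_le_of_collision hN hu (by omega) (by omega) ?_ (by omega) ?_
        (hval.symm.trans h)
      · split_ifs <;> omega
      · rintro ⟨h1, h2, h3⟩
        split_ifs at h2
        · refine hxy ?_
          rw [← Nat.pair_unpair x, ← Nat.pair_unpair y, ← Nat.pair_unpair x.unpair.2,
            ← Nat.pair_unpair y.unpair.2, h1, h2, h3]
        · exact hu h2
    rw [hval]
    exact Nat.add_le_add (Nat.mul_le_mul (by omega) hle) (by omega)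
  · have hval : smoothVal q N x = x.unpair.2.unpair.2 := by simp [smoothVal, smoothValue, hx]
    rw [hval]
    exact Nat.le_add_left_of_le (by omega)

theorem dvd_pow_self_mul_iff {q a u : ℕ} (ha : a ∣ q ^ a) :
    a * u ∣ q ^ (a * u) ↔ u ∣ q ^ u := by
  have prime_dvd : ∀ {b p : ℕ}, b ∣ q ^ b → p.Prime → p ∣ b → p ∣ q := fun hb hp hpb =>
    hp.dvd_of_dvd_pow (hpb.trans hb)
  have ha0 := pos_of_dvd_pow_self ha
  constructor <;> intro h
  · have h0 := pos_of_dvd_pow_self h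
    exact Nat.dvd_pow_self_of_forall_prime (right_ne_zero_of_mul h0) fun p hp hpu =>
      prime_dvd h hp (hpu.mul_left a)
  · refine Nat.dvd_pow_self_of_forall_prime (mul_ne_zero ha0 (pos_of_dvd_pow_self h))
      fun p hp hpu => ?_
    rcases (hp.dvd_mul).1 hpu with hpa | hpu
    · exact prime_dvd ha hp hpa
    · exact prime_dvd h hp hpu

theorem smoothValue_linear {q a : ℕ} (N : ℕ → ℕ) (ha : a ∣ q ^ a) (k u v b : ℕ) :
    smoothValue q N k (a * u) (a * v + b) = a * smoothValue q N k u v + b := by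
  simp only [smoothValue, dvd_pow_self_mul_iff ha]
  split_ifs <;> ring

theorem exists_primrec_lift_linear_iff {q : ℕ} {N : ℕ → ℕ}
    (hN : ∀ j k, j < k → (N j + 1) ^ 2 ≤ N k)
    (hesc : ∀ h : ℕ → ℕ, Primrec h → ∃ k, h k < N k) {a : ℕ} (ha : a ≠ 0) (b : ℕ) :
    (∃ F : ℕ → ℕ, Primrec F ∧ ∀ x, smoothVal q N (F x) = a * smoothVal q N x + b) ↔
      a ∣ q ^ a := by
  constructor
  · rintro ⟨F, hF, hFv⟩
    by_contra hns
    let G : ℕ → ℕ := fun k => F (tripleCode k 1 0)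
    have hG : Primrec G :=
      hF.comp (Primrec.tripleCode Primrec.id (Primrec.const 1) (Primrec.const 0))
    let B : ℕ → ℕ := fun k => G k + (a + b)
    have hB : Primrec B := Primrec.nat_add.comp hG (Primrec.const _)
    obtain ⟨k, hk⟩ := hesc _ (Primrec.nat_add.comp (Primrec.nat_mul.comp hB hB) hB)
    refine hk.not_ge ?_
    have hBk : B k = G k + (a + b) := rfl
    have hGv : smoothVal q N (G k) = a * N k + b := by
      rw [hFv, smoothVal_tripleCode]
      simp [smoothValue]
    have h1 : (G k).unpair.2.unpair.1 ≤ G k :=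
      (Nat.unpair_left_le _).trans (Nat.unpair_right_le _)
    have h2 : (G k).unpair.2.unpair.2 ≤ G k :=
      (Nat.unpair_right_le _).trans (Nat.unpair_right_le _)
    refine sparse_le_of_collision hN (b := B k) ha (by omega) (by omega) ?_ (by omega) ?_
      hGv.symm
    · split_ifs <;> omega
    · rintro ⟨-, hau, -⟩
      split_ifs at hau with hs
      · exact hns (hau ▸ hs)
      · exact ha hau
  · intro hs
    refine ⟨fun x => tripleCode x.unpair.1 (a * x.unpair.2.unpair.1)
      (a * x.unpair.2.unpair.2 + b), ?_, fun x => ?_⟩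
    · exact Primrec.tripleCode primrec_unpair_fst
        (Primrec.nat_mul.comp (Primrec.const a) primrec_unpair_snd_fst)
        (Primrec.nat_add.comp (Primrec.nat_mul.comp (Primrec.const a) primrec_unpair_snd_snd)
          (Primrec.const b))
    · rw [smoothVal_tripleCode, smoothValue_linear N hs]
      rfl

theorem stmt_5 (P : Finset ℕ) (hP : ∀ p ∈ P, Nat.Prime p) :
    ∃ c : ℕ ≃ ℕ,
      Primrec (fun x => c (c.symm x + 1)) ∧
      ∀ a b : ℕ, 0 < a →
        (Primrec (fun x => c (a * c.symm x + b)) ↔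
          ∀ p : ℕ, Nat.Prime p → p ∣ a → p ∈ P) := by
  obtain ⟨N, hN, hgraph, hesc⟩ := exists_sparse_sequence
  let q := ∏ p ∈ P, p
  have hβ : Primrec₂ fun x y : ℕ => (x + y) * ((x + y) * (x + y) + (x + y)) + (x + y) :=
    have hs : Primrec fun p : ℕ × ℕ => p.1 + p.2 := Primrec.nat_add
    Primrec.nat_add.comp (Primrec.nat_mul.comp hs
      (Primrec.nat_add.comp (Primrec.nat_mul.comp hs hs) hs)) hs
  have hg : Primrec fun n => tripleCode 0 0 n :=
    Primrec.tripleCode (Primrec.const 0) (Primrec.const 0) Primrec.id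
  have hgm : Monotone fun n => tripleCode 0 0 n :=
    ((strictMono_nat_of_lt_succ fun n => Nat.pair_lt_pair_right 0 (Nat.lt_succ_self n)).comp
      (strictMono_nat_of_lt_succ fun n => Nat.pair_lt_pair_right 0 (Nat.lt_succ_self n))).monotone
  obtain ⟨c, hc⟩ := exists_equiv_primrec_conj_iff (primrecRel_smoothVal q hgraph) hg hgm
    (fun n => by simp [smoothVal_tripleCode, smoothValue]) hβ
    (fun x y hxy h => smoothVal_le_of_collision hN hxy h)
  have hlin : ∀ a b : ℕ, 0 < a →
      (Primrec (fun x => c (a * c.symm x + b)) ↔ a ∣ q ^ a) := fun a b ha =>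
    (hc fun n => a * n + b).trans (exists_primrec_lift_linear_iff hN hesc ha.ne' b)
  refine ⟨c, ?_, fun a b ha => (hlin a b ha).trans ⟨fun h p hp hpa => ?_, fun h => ?_⟩⟩
  · simpa using (hlin 1 1 one_pos).2 (one_dvd _)
  · obtain ⟨r, hr, hpr⟩ := (hp.prime.dvd_finsetProd_iff _).1 (hp.dvd_of_dvd_pow (hpa.trans h))
    rwa [(Nat.prime_dvd_prime_iff_eq hp (hP r hr)).1 hpr]
  · exact Nat.dvd_pow_self_of_forall_prime ha.ne' fun p hp hpa =>
      Finset.dvd_prod_of_mem _ (h p hp hpa)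
end
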